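/- Let F be a cone subequation on ℝⁿ satisfying condition (F3), let Ω ⊂ ℝⁿ be a bounded domain with smooth strictly F-convex boundary, let φ ∈ C(∂Ω), let x₁,…,x_k ∈ Ω, and for each j let h_j be a downward-pointing singular F-harmonic of polar type at x_j. Assume Hypothesis (H): there exists a continuous F-subharmonic function ψ : Ω̄ → [−∞,∞), finite except at x₁,…,x_k, with ψ ≈ h_j at each x_j. Then there exists H, continuous on Ω̄ ∖ {x₁,…,x_k}, F-harmonic on Ω ∖ {x₁,…,x_k}, with H = φ on ∂Ω and H ≈ h_j at each x_j; moreover H is uniquely determined as the Perron function H(x) = sup{v(x) : v upper semicontinuous on Ω̄, F-subharmonic on Ω, v ≤ φ on ∂Ω, and v − h_j bounded above near each x_j}. -/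

import Mathlib

open scoped Topology Classical
open Filter

noncomputable section

/-- Euclidean space ℝⁿ. -/
abbrev EucSp (n : ℕ) := EuclideanSpace ℝ (Fin n)

/-- The space Sym²(ℝⁿ) of symmetric real n×n matrices, with its subspace topology. -/
abbrev SymMat (n : ℕ) := selfAdjoint (Matrix (Fin n) (Fin n) ℝ)

variable {n : ℕ}

/-- The matrix of the orthogonal projection onto the line ℝ·e (for a unit vector e). -/
def projMat (e : EucSp n) : Matrix (Fin n) (Fin n) ℝ := Matrix.of fun i j => e i * e j

lemma projMat_selfAdjoint (e : EucSp n) :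
    projMat e ∈ selfAdjoint (Matrix (Fin n) (Fin n) ℝ) := by
  rw [selfAdjoint.mem_iff]
  ext i j
  simp [projMat, Matrix.star_apply, mul_comm]

/-- P_e, the projection onto ℝ·e, as an element of Sym²(ℝⁿ). -/
def symProj (e : EucSp n) : SymMat n := ⟨projMat e, projMat_selfAdjoint e⟩

/-- The matrix P_{e⊥} − (p−1)·P_e. -/
def charMatM (p : ℝ) (e : EucSp n) : Matrix (Fin n) (Fin n) ℝ :=
  (1 - projMat e) - (p - 1) • projMat e

lemma charMatM_selfAdjoint (p : ℝ) (e : EucSp n) :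
    charMatM p e ∈ selfAdjoint (Matrix (Fin n) (Fin n) ℝ) := by
  have h := projMat_selfAdjoint e
  rw [selfAdjoint.mem_iff] at h ⊢
  simp [charMatM, star_sub, star_smul, star_one, h]

/-- P_{e⊥} − (p−1)·P_e as an element of Sym²(ℝⁿ). -/
def charMat (p : ℝ) (e : EucSp n) : SymMat n := ⟨charMatM p e, charMatM_selfAdjoint p e⟩

/-- A (constant coefficient, pure second order) cone subequation on ℝⁿ: a nonempty,
closed, proper subset of Sym²(ℝⁿ) satisfying positivity (F1) and the cone property (F2). -/
structure ConeSubequation (n : ℕ) where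
  carrier : Set (SymMat n)
  nonempty' : carrier.Nonempty
  proper' : carrier ≠ Set.univ
  isClosed' : IsClosed carrier
  f1 : ∀ A ∈ carrier, ∀ P : SymMat n, (P : Matrix (Fin n) (Fin n) ℝ).PosSemidef → A + P ∈ carrier
  f2 : ∀ A ∈ carrier, ∀ t : ℝ, 0 < t → t • A ∈ carrier

/-- The dual of a set of symmetric matrices: F̃ = {A : −A ∉ Int F}. -/
def dualSet (S : Set (SymMat n)) : Set (SymMat n) := {A | -A ∉ interior S}

/-- The subequation P = {A ≥ 0} of positive semidefinite matrices. -/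
def PosP (n : ℕ) : Set (SymMat n) := {A | (A : Matrix (Fin n) (Fin n) ℝ).PosSemidef}

/-- The Hessian matrix (D²f)(x) of a real function on ℝⁿ. -/
def hessMatrix (f : EucSp n → ℝ) (x : EucSp n) : Matrix (Fin n) (Fin n) ℝ :=
  Matrix.of fun i j =>
    iteratedFDeriv ℝ 2 f x ![EuclideanSpace.single i 1, EuclideanSpace.single j 1]

/-- ψ is a test function for u at x₀ (relative to the set X): ψ is C² near x₀,
u ≤ ψ near x₀ (within X), and u(x₀) = ψ(x₀). -/
def IsTestAt (X : Set (EucSp n)) (u : EucSp n → EReal) (ψ : EucSp n → ℝ) (x₀ : EucSp n) :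
    Prop :=
  ContDiffAt ℝ 2 ψ x₀ ∧ (∀ᶠ x in 𝓝[X] x₀, u x ≤ (ψ x : EReal)) ∧ u x₀ = (ψ x₀ : EReal)

/-- u admits no test functions at x₀ (relative to X). -/
def NoTestAt (X : Set (EucSp n)) (u : EucSp n → EReal) (x₀ : EucSp n) : Prop :=
  ∀ ψ : EucSp n → ℝ, ¬ IsTestAt X u ψ x₀

/-- u is S-subharmonic on X (viscosity sense): u is upper semicontinuous on X with values
in [−∞,∞), and for every test function ψ for u at a point of X, the Hessian of ψ there
lies in S. -/
def FSubharmonicOn (S : Set (SymMat n)) (X : Set (EucSp n)) (u : EucSp n → EReal) : Prop :=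
  UpperSemicontinuousOn u X ∧ (∀ x ∈ X, u x ≠ ⊤) ∧
    ∀ x₀ ∈ X, ∀ ψ : EucSp n → ℝ, IsTestAt X u ψ x₀ →
      hessMatrix ψ x₀ ∈ Subtype.val '' S

/-- u is F-harmonic on X: u is F-subharmonic and −u is F̃-subharmonic on X. -/
def FHarmonicOn (F : ConeSubequation n) (X : Set (EucSp n)) (u : EucSp n → EReal) : Prop :=
  FSubharmonicOn F.carrier X u ∧ FSubharmonicOn (dualSet F.carrier) X (fun x => -u x)

/-- u is subaffine on X, i.e. P̃-subharmonic on X. -/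
def SubaffineOn (X : Set (EucSp n)) (u : EucSp n → EReal) : Prop :=
  FSubharmonicOn (dualSet (PosP n)) X u

/-- h is a downward-pointing singular F-harmonic at x₀ on the neighborhood U:
continuous, F-subharmonic on U, F-harmonic on U∖{x₀}, with a strict minimum at x₀, and
either of polar type (h(x₀) = −∞) or of finite type (h(x₀) > −∞, no test functions at x₀). -/
structure DPSingular (F : ConeSubequation n) (U : Set (EucSp n)) (x₀ : EucSp n)
    (h : EucSp n → EReal) : Prop where
  isOpen' : IsOpen U
  mem : x₀ ∈ U
  cont : ContinuousOn h U
  subh : FSubharmonicOn F.carrier U h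
  harm : FHarmonicOn F (U \ {x₀}) h
  strictMin : ∀ x ∈ U, x ≠ x₀ → h x₀ < h x
  polarOrFinite : h x₀ = ⊥ ∨ (h x₀ ≠ ⊥ ∧ NoTestAt U h x₀)

/-- Polar-case asymptotic equivalence H ≈ h at x₀: h − C ≤ H ≤ h + C near x₀. -/
def PolarAsymp (H : EucSp n → ℝ) (h : EucSp n → EReal) (x₀ : EucSp n) : Prop :=
  ∃ C : ℝ, ∀ᶠ x in 𝓝[≠] x₀, h x - (C : EReal) ≤ (H x : EReal) ∧ (H x : EReal) ≤ h x + (C : EReal)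

/-- Finite-case asymptotic equivalence H ∼ h at x₀:
lim_{x→x₀} (H(x) − H(x₀))/(h(x) − h(x₀)) = 1. -/
def FiniteAsymp (H : EucSp n → ℝ) (h : EucSp n → EReal) (x₀ : EucSp n) : Prop :=
  Tendsto (fun x => (H x - H x₀) / ((h x).toReal - (h x₀).toReal)) (𝓝[≠] x₀) (𝓝 1)

/-- Ω is a bounded domain: open, connected and bounded. -/
def IsBoundedDomain (Ω : Set (EucSp n)) : Prop :=
  IsOpen Ω ∧ IsConnected Ω ∧ Bornology.IsBounded Ω

/-- Condition (F3): −P_e ∉ F for every unit vector e. -/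
def CondF3 (F : ConeSubequation n) : Prop :=
  ∀ e : EucSp n, ‖e‖ = 1 → -(symProj e) ∉ F.carrier

/-- The inward unit normal −∇ρ(x)/|∇ρ(x)| of the hypersurface {ρ = 0} bounding {ρ < 0}. -/
def innerNormal (ρ : EucSp n → ℝ) (x : EucSp n) : EucSp n :=
  -(‖gradient ρ x‖⁻¹ • gradient ρ x)

/-- The second fundamental form of {ρ = 0} at x with respect to the inward normal,
extended by zero on the normal line: the tangential part of Hess ρ(x)/|∇ρ(x)|. -/
def secondFF (ρ : EucSp n → ℝ) (x : EucSp n) : Matrix (Fin n) (Fin n) ℝ :=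
  ‖gradient ρ x‖⁻¹ •
    ((1 - projMat (innerNormal ρ x)) * hessMatrix ρ x * (1 - projMat (innerNormal ρ x)))

/-- Ω has smooth boundary which is strictly F-convex: Ω is globally defined by a smooth
defining function ρ with nonvanishing gradient along ∂Ω, and at every boundary point
II_x + t·P_{ν(x)} ∈ Int F for all sufficiently large t. -/
def StrictlyConvexBoundary (F : ConeSubequation n) (Ω : Set (EucSp n)) : Prop :=
  ∃ ρ : EucSp n → ℝ, ContDiff ℝ (⊤ : ℕ∞) ρ ∧ Ω = {x | ρ x < 0} ∧
    ∀ x ∈ frontier Ω, gradient ρ x ≠ 0 ∧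
      ∃ t₀ : ℝ, ∀ t ≥ t₀,
        secondFF ρ x + t • projMat (innerNormal ρ x) ∈ Subtype.val '' interior F.carrier

/-- F is invariant under O(n): gᵀ A g ∈ F for every orthogonal g and A ∈ F. -/
def OrthInvariant (F : ConeSubequation n) : Prop :=
  ∀ g : Matrix (Fin n) (Fin n) ℝ, g.transpose * g = 1 →
    ∀ A ∈ F.carrier, ∀ B : SymMat n,
      (B : Matrix (Fin n) (Fin n) ℝ) = g.transpose * (A : Matrix (Fin n) (Fin n) ℝ) * g →
      B ∈ F.carrier

/-- F has Riesz characteristic p: P_{e⊥} − (p−1)P_e ∈ ∂F for every unit vector e. -/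
def HasRieszChar (F : ConeSubequation n) (p : ℝ) : Prop :=
  ∀ e : EucSp n, ‖e‖ = 1 → charMat p e ∈ frontier F.carrier

/-- The Riesz kernel K_p. -/
def rieszKernel (p : ℝ) (x : EucSp n) : ℝ :=
  if p = 2 then Real.log ‖x‖ else -(p - 2)⁻¹ * ‖x‖ ^ (2 - p)

section

open scoped RealInnerProductSpace

/-- The linear operator on ℝⁿ attached to a symmetric matrix. -/
def symOp (A : SymMat n) : EucSp n →L[ℝ] EucSp n :=
  Matrix.toEuclideanCLM (𝕜 := ℝ) (A : Matrix (Fin n) (Fin n) ℝ)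

lemma symOp_add (A B : SymMat n) : symOp (A + B) = symOp A + symOp B := by
  simp [symOp]

lemma symOp_neg (A : SymMat n) : symOp (-A) = -symOp A := by
  simp [symOp]

lemma symOp_smul (t : ℝ) (A : SymMat n) : symOp (t • A) = t • symOp A := by
  simp [symOp]

lemma symOp_one : symOp (1 : SymMat n) = ContinuousLinearMap.id ℝ _ := by
  simp [symOp]; rfl

lemma symOp_apply (A : SymMat n) (z : EucSp n) (i : Fin n) :
    symOp A z i = ∑ j, (A : Matrix (Fin n) (Fin n) ℝ) i j * z j := by
  simp [symOp, Matrix.mulVec, dotProduct]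

lemma symMat_apply_comm (A : SymMat n) (i j : Fin n) :
    (A : Matrix (Fin n) (Fin n) ℝ) i j = (A : Matrix (Fin n) (Fin n) ℝ) j i := by
  have h := A.2
  rw [selfAdjoint.mem_iff] at h
  conv_lhs => rw [← h]
  simp [Matrix.star_apply]

lemma inner_symOp (A : SymMat n) (x y : EucSp n) :
    ⟪x, symOp A y⟫ = ∑ i, ∑ j, (A : Matrix (Fin n) (Fin n) ℝ) i j * x i * y j := by
  simp only [PiLp.inner_apply, symOp_apply]
  refine Finset.sum_congr rfl fun i _ => ?_
  simp [mul_comm, Finset.mul_sum, mul_left_comm]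
  exact Finset.sum_congr rfl fun j _ => by ring

lemma inner_symOp_comm (A : SymMat n) (x y : EucSp n) :
    ⟪x, symOp A y⟫ = ⟪y, symOp A x⟫ := by
  rw [inner_symOp, inner_symOp, Finset.sum_comm]
  refine Finset.sum_congr rfl fun i _ => Finset.sum_congr rfl fun j _ => ?_
  rw [symMat_apply_comm A j i]; ring

/-- The quadratic form of a symmetric matrix. -/
def quadForm (A : SymMat n) (z : EucSp n) : ℝ := ⟪z, symOp A z⟫

lemma quadForm_add (A B : SymMat n) (z : EucSp n) :
    quadForm (A + B) z = quadForm A z + quadForm B z := by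
  simp [quadForm, symOp_add, inner_add_right]

lemma quadForm_neg (A : SymMat n) (z : EucSp n) : quadForm (-A) z = -quadForm A z := by
  simp [quadForm, symOp_neg]

lemma quadForm_sub (A B : SymMat n) (z : EucSp n) :
    quadForm (A - B) z = quadForm A z - quadForm B z := by
  rw [sub_eq_add_neg, quadForm_add, quadForm_neg, sub_eq_add_neg]

lemma quadForm_smul (t : ℝ) (A : SymMat n) (z : EucSp n) :
    quadForm (t • A) z = t * quadForm A z := by
  simp [quadForm, symOp_smul, inner_smul_right]

lemma quadForm_one (z : EucSp n) : quadForm (1 : SymMat n) z = ‖z‖ ^ 2 := by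
  simp [quadForm, symOp_one]

lemma quadForm_zero (z : EucSp n) : quadForm (0 : SymMat n) z = 0 := by
  have := quadForm_smul 0 (0 : SymMat n) z
  simpa using this

lemma quadForm_vec_zero (A : SymMat n) : quadForm A 0 = 0 := by simp [quadForm]

lemma quadForm_vec_smul (A : SymMat n) (t : ℝ) (z : EucSp n) :
    quadForm A (t • z) = t ^ 2 * quadForm A z := by
  simp [quadForm, inner_smul_left, inner_smul_right]; ring

lemma quadForm_vec_neg (A : SymMat n) (z : EucSp n) : quadForm A (-z) = quadForm A z := by
  simp [quadForm]

lemma quadForm_vec_add (A : SymMat n) (x y : EucSp n) :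
    quadForm A (x + y) = quadForm A x + 2 * ⟪symOp A x, y⟫ + quadForm A y := by
  simp only [quadForm, map_add, inner_add_left, inner_add_right]
  rw [inner_symOp_comm A x y, real_inner_comm y]; ring

lemma abs_quadForm_le (A : SymMat n) (z : EucSp n) :
    |quadForm A z| ≤ ‖symOp A‖ * ‖z‖ ^ 2 := by
  refine (abs_real_inner_le_norm _ _).trans ?_
  nlinarith [(symOp A).le_opNorm z, norm_nonneg z]

lemma quadForm_symProj (e z : EucSp n) : quadForm (symProj e) z = ⟪e, z⟫ ^ 2 := by
  rw [quadForm, inner_symOp, PiLp.inner_apply, sq, Finset.sum_mul_sum]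
  refine Finset.sum_congr rfl fun i _ => Finset.sum_congr rfl fun j _ => ?_
  simp [symProj, projMat]; ring

lemma posSemidef_iff (A : SymMat n) :
    (A : Matrix (Fin n) (Fin n) ℝ).PosSemidef ↔ ∀ z, 0 ≤ quadForm A z := by
  rw [Matrix.posSemidef_iff_dotProduct_mulVec]
  have key : ∀ z : EucSp n, quadForm A z =
      star z.ofLp ⬝ᵥ ((A : Matrix (Fin n) (Fin n) ℝ).mulVec z.ofLp) := by
    intro z
    rw [quadForm, inner_symOp]
    simp [dotProduct, Matrix.mulVec, Finset.mul_sum, mul_left_comm, mul_assoc]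
  constructor
  · intro h z
    rw [key]; exact h.2 _
  · intro h
    refine ⟨A.2, fun z => ?_⟩
    have := h (WithLp.toLp 2 z)
    rwa [key] at this

lemma quadForm_sub_le_entries (A : SymMat n) (z : EucSp n) :
    |quadForm A z| ≤ (∑ i, ∑ j, |(A : Matrix (Fin n) (Fin n) ℝ) i j|) * ‖z‖ ^ 2 := by
  rw [quadForm, inner_symOp, Finset.sum_mul]
  refine (Finset.abs_sum_le_sum_abs _ _).trans (Finset.sum_le_sum fun i _ => ?_)
  rw [Finset.sum_mul]
  refine (Finset.abs_sum_le_sum_abs _ _).trans (Finset.sum_le_sum fun j _ => ?_)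
  rw [mul_assoc, abs_mul, abs_mul, sq]
  have h1 : |z i| ≤ ‖z‖ := by simpa using PiLp.norm_apply_le z i
  have h2 : |z j| ≤ ‖z‖ := by simpa using PiLp.norm_apply_le z j
  gcongr

/-- The symmetric matrix of the quadratic form of a linear operator. -/
def symPart (T : EucSp n →L[ℝ] EucSp n) : SymMat n :=
  ⟨Matrix.of fun i j => (T (EuclideanSpace.single j 1) i + T (EuclideanSpace.single i 1) j) / 2, by
    rw [selfAdjoint.mem_iff]
    ext i j
    simp [Matrix.star_apply, add_comm]⟩

lemma quadForm_symPart (T : EucSp n →L[ℝ] EucSp n) (z : EucSp n) :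
    quadForm (symPart T) z = ⟪z, T z⟫ := by
  have hz : T z = ∑ j, z j • T (EuclideanSpace.single j 1) := by
    conv_lhs => rw [show z = ∑ j, z j • EuclideanSpace.single j (1 : ℝ) by
      ext i; simp [Finset.sum_apply, Pi.single_apply]]
    rw [map_sum]; simp
  rw [quadForm, inner_symOp, PiLp.inner_apply]
  have h1 : ∀ i, ⟪z i, (T z) i⟫ = ∑ j, T (EuclideanSpace.single j 1) i * z i * z j := by
    intro i
    rw [hz]
    simp [Finset.mul_sum, mul_comm, mul_left_comm]
  simp_rw [h1]
  simp only [symPart, Matrix.of_apply]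
  have : ∀ i j, (T (EuclideanSpace.single j 1) i + T (EuclideanSpace.single i 1) j) / 2 * z i * z j
      = (T (EuclideanSpace.single j 1) i * z i * z j) / 2
        + (T (EuclideanSpace.single i 1) j * z j * z i) / 2 := by
    intro i j; ring
  simp_rw [this, Finset.sum_add_distrib]
  rw [Finset.sum_comm (f := fun i j => (T (EuclideanSpace.single i 1) j * z j * z i) / 2),
    ← Finset.sum_add_distrib]
  simp_rw [← Finset.sum_add_distrib]
  simp

/-- The quadratic polynomial with value `c`, gradient `a` and Hessian `A` at `x₀`. -/
def quadPoly (c : ℝ) (a : EucSp n) (A : SymMat n) (x₀ x : EucSp n) : ℝ :=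
  c + ⟪a, x - x₀⟫ + quadForm A (x - x₀) / 2

lemma quadPoly_self (c : ℝ) (a : EucSp n) (A : SymMat n) (x₀ : EucSp n) :
    quadPoly c a A x₀ x₀ = c := by
  simp [quadPoly, quadForm_vec_zero]

lemma quadPoly_recenter (c : ℝ) (a : EucSp n) (A : SymMat n) (x₀ y x : EucSp n) :
    quadPoly c a A x₀ x = quadPoly (quadPoly c a A x₀ y) (a + symOp A (y - x₀)) A y x := by
  have : x - x₀ = (y - x₀) + (x - y) := by abel
  simp only [quadPoly]
  rw [this, quadForm_vec_add, inner_add_right, inner_add_left]; ring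

lemma quadPoly_add_smul_one (c : ℝ) (a : EucSp n) (A : SymMat n) (x₀ x : EucSp n) (δ : ℝ) :
    quadPoly c a (A + (2 * δ) • (1 : SymMat n)) x₀ x
      = quadPoly c a A x₀ x + δ * ‖x - x₀‖ ^ 2 := by
  simp only [quadPoly, quadForm_add, quadForm_smul, quadForm_one]; ring

lemma continuous_quadForm (A : SymMat n) : Continuous (quadForm A) := by
  unfold quadForm; fun_prop

lemma continuous_quadPoly (c : ℝ) (a : EucSp n) (A : SymMat n) (x₀ : EucSp n) :
    Continuous (quadPoly c a A x₀) := by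
  have := continuous_quadForm A
  unfold quadPoly; fun_prop

lemma hasFDerivAt_quadPoly (c : ℝ) (a : EucSp n) (A : SymMat n) (x₀ x : EucSp n) :
    HasFDerivAt (quadPoly c a A x₀) (innerSL ℝ (a + symOp A (x - x₀))) x := by
  have h1 : HasFDerivAt (fun x : EucSp n => x - x₀) (ContinuousLinearMap.id ℝ _) x :=
    (hasFDerivAt_id x).sub_const x₀
  have h2 := (h1.inner ℝ ((symOp A).hasFDerivAt.comp x h1))
  have h3 := ((innerSL ℝ a).hasFDerivAt.comp x h1)
  have h4 := (h3.const_add c).add (h2.const_mul (1 / 2))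
  refine (h4.congr_fderiv ?_).congr_of_eventuallyEq ?_
  · ext v
    simp only [one_div, add_apply, ContinuousLinearMap.comp_apply,
      ContinuousLinearMap.id_apply, smul_apply, fderivInnerCLM_apply,
      ContinuousLinearMap.prod_apply, Function.comp_apply, smul_eq_mul, innerSL_apply_apply,
      inner_add_left]
    rw [inner_symOp_comm, real_inner_comm v (symOp A (x - x₀))]
    ring
  · refine Eventually.of_forall fun y => ?_
    simp [quadPoly, quadForm]; ring

lemma contDiff_quadPoly (c : ℝ) (a : EucSp n) (A : SymMat n) (x₀ : EucSp n) :
    ContDiff ℝ 2 (quadPoly c a A x₀) := by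
  unfold quadPoly quadForm
  have h1 : ContDiff ℝ 2 fun x : EucSp n => x - x₀ := contDiff_id.sub contDiff_const
  have h2 : ContDiff ℝ 2 fun x : EucSp n => symOp A (x - x₀) := (symOp A).contDiff.comp h1
  exact (contDiff_const.add (contDiff_const.inner ℝ h1)).add ((h1.inner ℝ h2).div_const 2)

lemma hessMatrix_quadPoly (c : ℝ) (a : EucSp n) (A : SymMat n) (x₀ x : EucSp n) :
    hessMatrix (quadPoly c a A x₀) x = (A : Matrix (Fin n) (Fin n) ℝ) := by
  have h1 : fderiv ℝ (quadPoly c a A x₀) = fun x => innerSL ℝ (a + symOp A (x - x₀)) :=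
    funext fun x => (hasFDerivAt_quadPoly c a A x₀ x).fderiv
  have h2 : HasFDerivAt (fun x => innerSL ℝ (a + symOp A (x - x₀)))
      ((innerSL ℝ).comp (symOp A)) x := by
    have h1 : HasFDerivAt (fun x : EucSp n => x - x₀) (ContinuousLinearMap.id ℝ _) x :=
      (hasFDerivAt_id x).sub_const x₀
    have h2 := (innerSL ℝ (E := EucSp n)).hasFDerivAt.comp x
      (((symOp A).hasFDerivAt.comp x h1).const_add a)
    exact h2
  ext i j
  simp only [hessMatrix, Matrix.of_apply, iteratedFDeriv_two_apply, h1, h2.fderiv]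
  simp [symOp_apply, EuclideanSpace.inner_single_right]
  rw [symMat_apply_comm]

lemma continuous_smul_symMat (A : SymMat n) : Continuous fun t : ℝ => t • A :=
  Continuous.subtype_mk (continuous_id.smul continuous_const) _

lemma continuous_const_smul_symMat (t : ℝ) : Continuous fun C : SymMat n => t • C :=
  Continuous.subtype_mk (continuous_subtype_val.const_smul t) _

lemma continuous_add_smul_symMat (A B : SymMat n) : Continuous fun t : ℝ => A + (2 * t) • B :=
  continuous_const.add ((continuous_smul_symMat B).comp (continuous_const.mul continuous_id))

namespace ConeSubequation

variable (F : ConeSubequation n)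

lemma mem_of_quadForm_le {A B : SymMat n} (hA : A ∈ F.carrier)
    (h : ∀ z, quadForm A z ≤ quadForm B z) : B ∈ F.carrier := by
  have := F.f1 A hA (B - A) ((posSemidef_iff _).2 fun z => by rw [quadForm_sub]; linarith [h z])
  simpa using this

lemma mem_interior_of_quadForm_le {A B : SymMat n} (hA : A ∈ interior F.carrier)
    (h : ∀ z, quadForm A z ≤ quadForm B z) : B ∈ interior F.carrier := by
  rw [mem_interior]
  refine ⟨(fun C => C - (B - A)) ⁻¹' interior F.carrier, fun C hC => ?_,
    isOpen_interior.preimage (by fun_prop), by simpa using hA⟩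
  refine F.mem_of_quadForm_le (interior_subset hC) fun z => ?_
  rw [quadForm_sub, quadForm_sub]; linarith [h z]

lemma mem_interior_of_quadForm_add_le {A B : SymMat n} {δ : ℝ} (hA : A ∈ F.carrier) (hδ : 0 < δ)
    (h : ∀ z, quadForm A z + δ * ‖z‖ ^ 2 ≤ quadForm B z) : B ∈ interior F.carrier := by
  set N : SymMat n → ℝ := fun C => ∑ i, ∑ j, |((C - B : SymMat n) : Matrix (Fin n) (Fin n) ℝ) i j|
  have hN : Continuous N := by
    refine continuous_finsetSum _ fun i _ => continuous_finsetSum _ fun j _ => ?_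
    refine continuous_abs.comp ?_
    have : Continuous fun C : SymMat n => ((C - B : SymMat n) : Matrix (Fin n) (Fin n) ℝ) :=
      continuous_subtype_val.comp (by fun_prop)
    exact this.matrix_elem i j
  rw [mem_interior]
  refine ⟨N ⁻¹' Set.Iio δ, fun C hC => ?_, isOpen_Iio.preimage hN, by simp [N, hδ]⟩
  refine F.mem_of_quadForm_le hA fun z => ?_
  have h1 := (abs_le.1 (quadForm_sub_le_entries (C - B) z)).1
  rw [quadForm_sub] at h1
  have h2 : N C * ‖z‖ ^ 2 ≤ δ * ‖z‖ ^ 2 := by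
    have : N C < δ := hC
    gcongr
  have h3 := h z
  simp only [N] at h2
  linarith

lemma zero_mem : (0 : SymMat n) ∈ F.carrier := by
  obtain ⟨A, hA⟩ := F.nonempty'
  have h1 : Tendsto (fun t : ℝ => t • A) (𝓝[>] 0) (𝓝 ((0 : ℝ) • A)) :=
    Tendsto.mono_left ((continuous_smul_symMat A).tendsto _) nhdsWithin_le_nhds
  rw [zero_smul] at h1
  refine F.isClosed'.mem_of_tendsto h1 ?_
  filter_upwards [self_mem_nhdsWithin] with t ht
  exact F.f2 A hA t ht

lemma exists_sub_smul_one_mem {A : SymMat n} (hA : A ∈ interior F.carrier) :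
    ∃ δ : ℝ, 0 < δ ∧ A - (2 * δ) • (1 : SymMat n) ∈ interior F.carrier := by
  have h1 : Tendsto (fun t : ℝ => A + (2 * t) • (-1 : SymMat n)) (𝓝[>] 0)
      (𝓝 (A + (2 * 0 : ℝ) • (-1 : SymMat n))) :=
    Tendsto.mono_left ((continuous_add_smul_symMat A _).tendsto _) nhdsWithin_le_nhds
  rw [mul_zero, zero_smul, add_zero] at h1
  obtain ⟨δ, h2, h3⟩ := ((h1.eventually (isOpen_interior.mem_nhds hA)).and
    self_mem_nhdsWithin).exists
  exact ⟨δ, h3, by rwa [smul_neg, ← sub_eq_add_neg] at h2⟩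

lemma neg_smul_one_notMem {c : ℝ} (hc : 0 < c) : -(c • (1 : SymMat n)) ∉ F.carrier := by
  intro h
  refine F.proper' (Set.eq_univ_of_forall fun A => ?_)
  have h1 := F.f2 _ h ((‖symOp A‖ + 1) / c) (by positivity)
  refine F.mem_of_quadForm_le h1 fun z => ?_
  rw [quadForm_smul, quadForm_neg, quadForm_smul, quadForm_one]
  have h2 := (abs_le.1 (abs_quadForm_le A z)).1
  have : (‖symOp A‖ + 1) / c * -(c * ‖z‖ ^ 2) = -(‖symOp A‖ * ‖z‖ ^ 2) - ‖z‖ ^ 2 := by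
    field_simp; ring
  rw [this]
  nlinarith [sq_nonneg ‖z‖]

lemma smul_mem_dualSet {A : SymMat n} (hA : A ∈ dualSet F.carrier) {t : ℝ} (ht : 0 < t) :
    t • A ∈ dualSet F.carrier := by
  intro h
  refine hA ?_
  rw [mem_interior]
  refine ⟨(fun C => t • C) ⁻¹' interior F.carrier, fun C hC => ?_,
    isOpen_interior.preimage (continuous_const_smul_symMat t), by simpa using h⟩
  have := F.f2 _ (interior_subset hC) t⁻¹ (by positivity)
  rwa [smul_smul, inv_mul_cancel₀ ht.ne', one_smul] at this

end ConeSubequation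

lemma isClosed_dualSet (S : Set (SymMat n)) : IsClosed (dualSet S) := by
  rw [← isOpen_compl_iff]
  have : (dualSet S)ᶜ = (fun A => -A) ⁻¹' interior S := by
    ext A; simp [dualSet]
  rw [this]
  exact isOpen_interior.preimage (by fun_prop)

lemma mem_of_forall_add_smul_one_mem {S : Set (SymMat n)} (hS : IsClosed S) {A : SymMat n}
    (h : ∀ δ : ℝ, 0 < δ → A + (2 * δ) • (1 : SymMat n) ∈ S) : A ∈ S := by
  have h1 : Tendsto (fun t : ℝ => A + (2 * t) • (1 : SymMat n)) (𝓝[>] 0)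
      (𝓝 (A + (2 * 0 : ℝ) • (1 : SymMat n))) :=
    Tendsto.mono_left ((continuous_add_smul_symMat A _).tendsto _) nhdsWithin_le_nhds
  rw [mul_zero, zero_smul, add_zero] at h1
  refine hS.mem_of_tendsto h1 ?_
  filter_upwards [self_mem_nhdsWithin] with t ht
  exact h t ht

/-- Second order Taylor expansion of a `C²` function. -/
lemma exists_taylor_quadPoly {f : EucSp n → ℝ} {x₀ : EucSp n} (hf : ContDiffAt ℝ 2 f x₀) :
    ∃ A : SymMat n, (A : Matrix (Fin n) (Fin n) ℝ) = hessMatrix f x₀ ∧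
      ∀ δ : ℝ, 0 < δ → ∀ᶠ x in 𝓝 x₀,
        |f x - quadPoly (f x₀) (gradient f x₀) A x₀ x| ≤ δ * ‖x - x₀‖ ^ 2 := by
  have hsymm : IsSymmSndFDerivAt ℝ f x₀ := hf.isSymmSndFDerivAt (by simp)
  have hA : hessMatrix f x₀ ∈ selfAdjoint (Matrix (Fin n) (Fin n) ℝ) := by
    rw [selfAdjoint.mem_iff]
    ext i j
    simp only [Matrix.star_apply, hessMatrix, Matrix.of_apply, iteratedFDeriv_two_apply, star_trivial]
    exact hsymm.eq _ _
  set A : SymMat n := ⟨hessMatrix f x₀, hA⟩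
  refine ⟨A, rfl, fun δ hδ => ?_⟩
  have hd : ∀ᶠ x in 𝓝 x₀, DifferentiableAt ℝ f x := by
    filter_upwards [hf.eventually (by simp)] with x hx
    exact hx.differentiableAt (by simp)
  have hdd : HasFDerivAt (fderiv ℝ f) (fderiv ℝ (fderiv ℝ f) x₀) x₀ :=
    ((hf.fderiv_right (m := 1) (by norm_num)).differentiableAt (by simp)).hasFDerivAt
  have hop : ∀ v w : EucSp n, fderiv ℝ (fderiv ℝ f) x₀ v w = ⟪symOp A v, w⟫ := by
    intro v w
    have e1 : ∀ z : EucSp n, z = ∑ j, z j • EuclideanSpace.single j (1 : ℝ) := fun z => by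
      ext i; simp [Finset.sum_apply, Pi.single_apply]
    rw [real_inner_comm, inner_symOp_comm, inner_symOp]
    have h2 : fderiv ℝ (fderiv ℝ f) x₀ v w = ∑ i, ∑ j, v i * (w j *
        fderiv ℝ (fderiv ℝ f) x₀ (EuclideanSpace.single i 1) (EuclideanSpace.single j 1)) := by
      conv_lhs => rw [e1 v, map_sum, FunLike.coe_sum, Finset.sum_apply]
      refine Finset.sum_congr rfl fun i _ => ?_
      conv_lhs => rw [e1 w, map_sum]
      refine Finset.sum_congr rfl fun j _ => ?_
      simp [mul_left_comm]
    rw [h2]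
    refine Finset.sum_congr rfl fun i _ => Finset.sum_congr rfl fun j _ => ?_
    simp [A, hessMatrix, iteratedFDeriv_two_apply]
    ring
  have hsm : ∀ᶠ x in 𝓝 x₀, ‖fderiv ℝ f x - fderiv ℝ f x₀ - fderiv ℝ (fderiv ℝ f) x₀ (x - x₀)‖
      ≤ δ * ‖x - x₀‖ := hdd.isLittleO.def hδ
  obtain ⟨r, hr, hball⟩ := Metric.eventually_nhds_iff_ball.1 (hd.and hsm)
  filter_upwards [Metric.ball_mem_nhds x₀ hr] with x hx
  set g : EucSp n → ℝ := fun y => f y - quadPoly (f x₀) (gradient f x₀) A x₀ y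
  have hg : ∀ y ∈ Metric.closedBall x₀ ‖x - x₀‖,
      HasFDerivWithinAt g (fderiv ℝ f y - innerSL ℝ (gradient f x₀ + symOp A (y - x₀)))
        (Metric.closedBall x₀ ‖x - x₀‖) y := by
    intro y hy
    have hy' : y ∈ Metric.ball x₀ r := by
      rw [mem_ball_iff_norm] at hx
      exact Metric.closedBall_subset_ball hx hy
    exact ((hball y hy').1.hasFDerivAt.sub (hasFDerivAt_quadPoly _ _ A x₀ y)).hasFDerivWithinAt
  have hbound : ∀ y ∈ Metric.closedBall x₀ ‖x - x₀‖,
      ‖fderiv ℝ f y - innerSL ℝ (gradient f x₀ + symOp A (y - x₀))‖ ≤ δ * ‖x - x₀‖ := by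
    intro y hy
    have hy' : y ∈ Metric.ball x₀ r := by
      rw [mem_ball_iff_norm] at hx
      exact Metric.closedBall_subset_ball hx hy
    have h1 := (hball y hy').2
    have h2 : innerSL ℝ (gradient f x₀ + symOp A (y - x₀))
        = fderiv ℝ f x₀ + fderiv ℝ (fderiv ℝ f) x₀ (y - x₀) := by
      ext w
      simp only [innerSL_apply_apply, inner_add_left, add_apply, hop]
      congr 1
      simp [gradient, InnerProductSpace.toDual_symm_apply]
    rw [h2, ← sub_sub]
    refine h1.trans ?_
    rw [mem_closedBall_iff_norm] at hy
    gcongr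
  have := (convex_closedBall x₀ ‖x - x₀‖).norm_image_sub_le_of_norm_hasFDerivWithin_le hg hbound
    (Metric.mem_closedBall_self (norm_nonneg _)) (mem_closedBall_iff_norm.2 le_rfl)
  simp only [g, quadPoly_self, sub_self, sub_zero, Real.norm_eq_abs] at this
  rw [sq, ← mul_assoc]
  exact this

/-- `A ∈ S` whenever a quadratic polynomial with Hessian `A` touches `u` from above at a point
of `X`. -/
def JetSub (S : Set (SymMat n)) (X : Set (EucSp n)) (u : EucSp n → EReal) : Prop :=
  ∀ x₀ ∈ X, ∀ (c : ℝ) (a : EucSp n) (A : SymMat n), u x₀ = (c : EReal) →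
    (∀ᶠ x in 𝓝 x₀, u x ≤ (quadPoly c a A x₀ x : ℝ)) → A ∈ S

lemma FSubharmonicOn.jetSub {S : Set (SymMat n)} {X : Set (EucSp n)} {u : EucSp n → EReal}
    (h : FSubharmonicOn S X u) : JetSub S X u := by
  intro x₀ hx₀ c a A hc hev
  obtain ⟨B, hB, hBA⟩ := h.2.2 x₀ hx₀ (quadPoly c a A x₀)
    ⟨(contDiff_quadPoly c a A x₀).contDiffAt, hev.filter_mono nhdsWithin_le_nhds, by
      rw [quadPoly_self, hc]⟩
  rw [hessMatrix_quadPoly] at hBA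
  rwa [← Subtype.ext hBA]

lemma JetSub.fSubharmonicOn {S : Set (SymMat n)} {X : Set (EucSp n)} {u : EucSp n → EReal}
    (hS : IsClosed S) (hX : IsOpen X) (h : JetSub S X u) (husc : UpperSemicontinuousOn u X)
    (htop : ∀ x ∈ X, u x ≠ ⊤) : FSubharmonicOn S X u := by
  refine ⟨husc, htop, fun x₀ hx₀ ψ hψ => ?_⟩
  obtain ⟨A, hA, hT⟩ := exists_taylor_quadPoly hψ.1
  refine ⟨A, mem_of_forall_add_smul_one_mem hS fun δ hδ => ?_, hA⟩
  refine h x₀ hx₀ (ψ x₀) (gradient ψ x₀) _ hψ.2.2 ?_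
  have h1 := hψ.2.1
  rw [hX.nhdsWithin_eq hx₀] at h1
  filter_upwards [h1, hT δ hδ] with x h1 h2
  refine h1.trans (EReal.coe_le_coe_iff.2 ?_)
  rw [quadPoly_add_smul_one]
  linarith [(abs_le.1 h2).2]

lemma JetSub.congr {S : Set (SymMat n)} {X : Set (EucSp n)} {u v : EucSp n → EReal}
    (hX : IsOpen X) (h : JetSub S X u) (huv : ∀ x ∈ X, u x = v x) : JetSub S X v := by
  intro x₀ hx₀ c a A hc hev
  refine h x₀ hx₀ c a A (by rw [huv x₀ hx₀, hc]) ?_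
  filter_upwards [hev, hX.mem_nhds hx₀] with x h1 h2
  rwa [huv x h2]

lemma JetSub.mono {S : Set (SymMat n)} {X Y : Set (EucSp n)} {u : EucSp n → EReal}
    (h : JetSub S X u) (hY : Y ⊆ X) : JetSub S Y u :=
  fun x₀ hx₀ => h x₀ (hY hx₀)

lemma le_of_forall_sub_ge_neg_mul_sq {g : ℝ → ℝ} {C : ℝ}
    (h : ∀ s t : ℝ, 0 ≤ s → s ≤ t → t ≤ 1 → -(C * (t - s) ^ 2) ≤ g t - g s) : g 0 ≤ g 1 := by
  have h1 : ∀ N : ℕ, -(C * (1 / ((N : ℝ) + 1))) ≤ g 1 - g 0 := by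
    intro N
    have hN : (0 : ℝ) < (N : ℝ) + 1 := by positivity
    have h2 := Finset.sum_range_sub (fun i : ℕ => g ((i : ℝ) / ((N : ℝ) + 1))) (N + 1)
    have h3 : ∑ i ∈ Finset.range (N + 1), -(C * (1 / ((N : ℝ) + 1)) ^ 2) ≤
        ∑ i ∈ Finset.range (N + 1), (g (((i + 1 : ℕ) : ℝ) / ((N : ℝ) + 1)) -
          g ((i : ℝ) / ((N : ℝ) + 1))) := by
      refine Finset.sum_le_sum fun i hi => ?_
      have hi' : ((i : ℝ) + 1) ≤ (N : ℝ) + 1 := by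
        exact_mod_cast Finset.mem_range.1 hi
      have := h ((i : ℝ) / ((N : ℝ) + 1)) (((i + 1 : ℕ) : ℝ) / ((N : ℝ) + 1)) (by positivity)
        (by gcongr; simp) (by push_cast; rw [div_le_one hN]; exact hi')
      have e : ((i + 1 : ℕ) : ℝ) / ((N : ℝ) + 1) - (i : ℝ) / ((N : ℝ) + 1) = 1 / ((N : ℝ) + 1) := by
        push_cast; ring
      rwa [e] at this
    rw [h2] at h3
    simp only [Finset.sum_const, Finset.card_range, nsmul_eq_mul] at h3
    have e1 : (((N + 1 : ℕ) : ℝ)) / ((N : ℝ) + 1) = 1 := by push_cast; exact div_self hN.ne'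
    rw [e1] at h3
    simp only [Nat.cast_zero, zero_div] at h3
    convert h3 using 1
    push_cast; field_simp
  have h2 : Tendsto (fun N : ℕ => -(C * (1 / ((N : ℝ) + 1)))) atTop (𝓝 (-(C * 0))) :=
    (tendsto_one_div_add_atTop_nhds_zero_nat.const_mul C).neg
  have := le_of_tendsto h2 (Eventually.of_forall h1)
  simp at this
  exact this

/-- A semiconvex function whose subgradient selection is differentiable at a point has a second
order expansion there. -/
lemma abs_sub_quadPoly_le_of_subgradient {U : EucSp n → ℝ} {a : EucSp n → EucSp n} {L : ℝ}
    (hU : ∀ x y, U x + ⟪a x, y - x⟫ - L / 2 * ‖y - x‖ ^ 2 ≤ U y) {x₀ : EucSp n}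
    {T : EucSp n →L[ℝ] EucSp n}
    (hT : ∀ η : ℝ, 0 < η → ∀ᶠ z in 𝓝 x₀, ‖a z - a x₀ - T (z - x₀)‖ ≤ η * ‖z - x₀‖)
    {η : ℝ} (hη : 0 < η) :
    ∀ᶠ x in 𝓝 x₀, |U x - quadPoly (U x₀) (a x₀) (symPart T) x₀ x| ≤ η * ‖x - x₀‖ ^ 2 := by
  obtain ⟨r, hr, hball⟩ := Metric.eventually_nhds_iff_ball.1 (hT η hη)
  filter_upwards [Metric.ball_mem_nhds x₀ hr] with x hx
  set z := x - x₀ with hz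
  have hzr : ‖z‖ < r := by rwa [mem_ball_iff_norm] at hx
  set e : ℝ → EucSp n := fun s => a (x₀ + s • z) - a x₀ - T (s • z) with he
  have hes : ∀ s : ℝ, 0 ≤ s → s ≤ 1 → |⟪e s, z⟫| ≤ η * ‖z‖ ^ 2 := by
    intro s h0 h1
    have hs : ‖s • z‖ ≤ ‖z‖ := by
      rw [norm_smul, Real.norm_eq_abs, abs_of_nonneg h0]
      exact mul_le_of_le_one_left (norm_nonneg _) h1
    have h2 := hball (x₀ + s • z) (by rw [mem_ball_iff_norm, add_sub_cancel_left]; linarith)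
    rw [add_sub_cancel_left] at h2
    refine (abs_real_inner_le_norm _ _).trans ?_
    calc ‖e s‖ * ‖z‖ ≤ (η * ‖z‖) * ‖z‖ := by
          gcongr
          exact h2.trans (by gcongr)
      _ = η * ‖z‖ ^ 2 := by ring
  set g : ℝ → ℝ := fun t => U (x₀ + t • z) - t * ⟪a x₀, z⟫ - t ^ 2 / 2 * ⟪z, T z⟫ with hg
  have key : ∀ s t : ℝ, g s + (t - s) * ⟪e s, z⟫ -
      (L / 2 * ‖z‖ ^ 2 + ⟪z, T z⟫ / 2) * (t - s) ^ 2 ≤ g t := by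
    intro s t
    have h1 := hU (x₀ + s • z) (x₀ + t • z)
    have e1 : x₀ + t • z - (x₀ + s • z) = (t - s) • z := by rw [sub_smul]; abel
    rw [e1, norm_smul, inner_smul_right, mul_pow, Real.norm_eq_abs, sq_abs] at h1
    have e2 : ⟪e s, z⟫ = ⟪a (x₀ + s • z), z⟫ - ⟪a x₀, z⟫ - s * ⟪z, T z⟫ := by
      simp only [he, inner_sub_left, map_smul, inner_smul_left, real_inner_comm z (T z)]
      simp
    rw [e2]
    simp only [hg]
    nlinarith [h1]
  set C := L / 2 * ‖z‖ ^ 2 + ⟪z, T z⟫ / 2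
  have hlow := le_of_forall_sub_ge_neg_mul_sq (g := fun t => g t + η * ‖z‖ ^ 2 * t) (C := C)
    (fun s t h0 h1 h2 => by
      have := key s t
      have h3 := (abs_le.1 (hes s h0 (h1.trans h2))).1
      have : (t - s) * -(η * ‖z‖ ^ 2) ≤ (t - s) * ⟪e s, z⟫ :=
        mul_le_mul_of_nonneg_left h3 (by linarith)
      linarith)
  have hupp := le_of_forall_sub_ge_neg_mul_sq (g := fun t => -g t + η * ‖z‖ ^ 2 * t) (C := C)
    (fun s t h0 h1 h2 => by
      have := key t s
      have h3 := (abs_le.1 (hes t (h0.trans h1) h2)).2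
      have : (t - s) * ⟪e t, z⟫ ≤ (t - s) * (η * ‖z‖ ^ 2) :=
        mul_le_mul_of_nonneg_left h3 (by linarith)
      have e3 : (s - t) ^ 2 = (t - s) ^ 2 := by ring
      nlinarith)
  have g0 : g 0 = U x₀ := by simp [hg]
  have g1 : g 1 = U x - ⟪a x₀, z⟫ - ⟪z, T z⟫ / 2 := by
    have e4 : x₀ + z = x := by simp [hz]
    simp [hg, e4]; ring
  simp only [g0, g1] at hlow hupp
  rw [quadPoly, quadForm_symPart, ← hz, abs_le]
  constructor <;> linarith

/-- `p` is a supergradient of `f` at `x`. -/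
def IsSupergradient (f : EucSp n → ℝ) (x p : EucSp n) : Prop :=
  ∀ y, f y ≤ f x + ⟪p, y - x⟫

section Semiconvex

variable {U W : EucSp n → ℝ} {a b : EucSp n → EucSp n} {L : ℝ}

lemma IsSupergradient.eq_add (hL : 0 < L)
    (hU : ∀ x y, U x + ⟪a x, y - x⟫ - L / 2 * ‖y - x‖ ^ 2 ≤ U y)
    (hW : ∀ x y, W x + ⟪b x, y - x⟫ - L / 2 * ‖y - x‖ ^ 2 ≤ W y) {x p : EucSp n}
    (h : IsSupergradient (fun y => U y + W y) x p) : p = a x + b x := by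
  set d := a x + b x - p
  set y := x + (1 / (2 * L)) • d
  have h1 := hU x y
  have h2 := hW x y
  have h3 := h y
  have e : y - x = (1 / (2 * L)) • d := by simp [y]
  rw [e, norm_smul, mul_pow, Real.norm_eq_abs, sq_abs] at h1 h2
  simp only [e] at h3
  have h4 : ⟪a x, (1 / (2 * L)) • d⟫ + ⟪b x, (1 / (2 * L)) • d⟫ - ⟪p, (1 / (2 * L)) • d⟫ =
      1 / (2 * L) * ‖d‖ ^ 2 := by
    rw [← inner_add_left, ← inner_sub_left, inner_smul_right, real_inner_self_eq_norm_sq]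
  have h5 : 1 / (2 * L) * ‖d‖ ^ 2 ≤ L * ((1 / (2 * L)) ^ 2 * ‖d‖ ^ 2) := by linarith
  have h6 : L * ((1 / (2 * L)) ^ 2 * ‖d‖ ^ 2) = 1 / (2 * L) * ‖d‖ ^ 2 / 2 := by
    field_simp
  have h7 : 0 < 1 / (2 * L) := by positivity
  have h8 : ‖d‖ ^ 2 ≤ 0 := by
    rw [h6] at h5
    by_contra hc
    push Not at hc
    have := mul_pos h7 hc
    linarith
  have h9 : ‖d‖ = 0 := by nlinarith [norm_nonneg d]
  exact (sub_eq_zero.1 (norm_eq_zero.1 h9)).symm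

lemma IsSupergradient.le_left (hL : 0 < L)
    (hU : ∀ x y, U x + ⟪a x, y - x⟫ - L / 2 * ‖y - x‖ ^ 2 ≤ U y)
    (hW : ∀ x y, W x + ⟪b x, y - x⟫ - L / 2 * ‖y - x‖ ^ 2 ≤ W y) {x p : EucSp n}
    (h : IsSupergradient (fun y => U y + W y) x p) (y : EucSp n) :
    U y ≤ U x + ⟪a x, y - x⟫ + L / 2 * ‖y - x‖ ^ 2 := by
  have h1 := h.eq_add hL hU hW
  have h2 := h y
  rw [h1, inner_add_left] at h2
  linarith [hW x y]

lemma norm_subgradient_sub_le (hL : 0 < L)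
    (hU : ∀ x y, U x + ⟪a x, y - x⟫ - L / 2 * ‖y - x‖ ^ 2 ≤ U y) {x : EucSp n}
    (hx : ∀ y, U y ≤ U x + ⟪a x, y - x⟫ + L / 2 * ‖y - x‖ ^ 2) (y : EucSp n) :
    ‖a y - a x‖ ≤ 3 * L * ‖y - x‖ := by
  set d := a y - a x
  set z := y + (1 / (3 * L)) • d
  have h1 := hU y z
  have h2 := hU x y
  have h3 := hx z
  have e : z - y = (1 / (3 * L)) • d := by simp [z]
  have e2 : z - x = (y - x) + (1 / (3 * L)) • d := by simp only [z]; abel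
  have e3 := parallelogram_law_with_norm ℝ (y - x) ((1 / (3 * L)) • d)
  rw [e] at h1
  rw [e2, inner_add_right] at h3
  have h4 : ⟪a y, (1 / (3 * L)) • d⟫ - ⟪a x, (1 / (3 * L)) • d⟫ = 1 / (3 * L) * ‖d‖ ^ 2 := by
    rw [← inner_sub_left, inner_smul_right, real_inner_self_eq_norm_sq]
  have e5 : ‖(1 / (3 * L)) • d‖ ^ 2 = (1 / (3 * L)) ^ 2 * ‖d‖ ^ 2 := by
    rw [norm_smul, mul_pow, Real.norm_eq_abs, sq_abs]
  have h6 : ‖(y - x) + (1 / (3 * L)) • d‖ ^ 2 ≤ 2 * ‖y - x‖ ^ 2 + 2 * ‖(1 / (3 * L)) • d‖ ^ 2 := by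
    nlinarith [sq_nonneg ‖y - x - (1 / (3 * L)) • d‖]
  have h7 : 1 / (3 * L) * ‖d‖ ^ 2 ≤ L / 2 * (3 * ‖y - x‖ ^ 2 + 3 * ‖(1 / (3 * L)) • d‖ ^ 2) := by
    nlinarith
  rw [e5] at h7
  have h8 : ‖d‖ ^ 2 ≤ (3 * L * ‖y - x‖) ^ 2 := by
    have h9 : L / 2 * (3 * ‖y - x‖ ^ 2 + 3 * ((1 / (3 * L)) ^ 2 * ‖d‖ ^ 2)) =
      L / 2 * 3 * ‖y - x‖ ^ 2 + 1 / (3 * L) * ‖d‖ ^ 2 / 2 := by field_simp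
    rw [h9] at h7
    have h10 : 1 / (3 * L) * ‖d‖ ^ 2 ≤ 3 * L * ‖y - x‖ ^ 2 := by linarith
    rw [div_mul_eq_mul_div, one_mul, div_le_iff₀ (by positivity)] at h10
    linarith
  exact abs_le_of_sq_le_sq h8 (by positivity) |> (le_abs_self _).trans

end Semiconvex

section

open scoped MeasureTheory

/-- At a density point `x` of `K`, every nearby point `z` is within `η‖z - x‖` of `K`. -/
lemma ae_eventually_exists_mem_closedBall (μ : MeasureTheory.Measure (EucSp n))
    [μ.IsAddHaarMeasure] (K : Set (EucSp n)) :
    ∀ᵐ x ∂μ.restrict K, ∀ η : ℝ, 0 < η → ∀ᶠ z in 𝓝[≠] x, ∃ y ∈ K, ‖y - z‖ ≤ η * ‖z - x‖ := by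
  have h1 : ∀ᵐ x ∂μ.restrict K, ∀ m : ℕ,
      ∀ᶠ z in 𝓝[≠] x, ∃ y ∈ K, ‖y - z‖ ≤ 1 / ((m : ℝ) + 1) * ‖z - x‖ := by
    rw [MeasureTheory.ae_all_iff]
    intro m
    filter_upwards [IsUnifLocDoublingMeasure.ae_tendsto_measure_inter_div μ K ((m : ℝ) + 1)]
      with x hx
    have hm : (0 : ℝ) < 1 / ((m : ℝ) + 1) := by positivity
    have h2 := hx (l := 𝓝[≠] x) (fun z => z) (fun z => 1 / ((m : ℝ) + 1) * ‖z - x‖) (by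
      rw [tendsto_nhdsWithin_iff]
      constructor
      · have : Tendsto (fun z => 1 / ((m : ℝ) + 1) * ‖z - x‖) (𝓝 x)
            (𝓝 (1 / ((m : ℝ) + 1) * ‖x - x‖)) := Continuous.tendsto (by fun_prop) _
        simp only [sub_self, norm_zero, mul_zero] at this
        exact this.mono_left nhdsWithin_le_nhds
      · filter_upwards [self_mem_nhdsWithin] with z hz
        exact mul_pos hm (norm_pos_iff.2 (sub_ne_zero.2 hz))) (by
      refine Eventually.of_forall fun z => ?_
      rw [Metric.mem_closedBall, dist_eq_norm, norm_sub_rev]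
      apply le_of_eq
      field_simp)
    filter_upwards [h2.eventually (lt_mem_nhds (zero_lt_one))] with z hz
    have h3 : (K ∩ Metric.closedBall z (1 / ((m : ℝ) + 1) * ‖z - x‖)).Nonempty := by
      by_contra hne
      rw [Set.not_nonempty_iff_eq_empty] at hne
      rw [hne] at hz
      simp at hz
    obtain ⟨y, hy, hyz⟩ := h3
    exact ⟨y, hy, by rwa [mem_closedBall_iff_norm] at hyz⟩
  filter_upwards [h1] with x hx η hη
  obtain ⟨m, hm⟩ := exists_nat_one_div_lt hη
  filter_upwards [hx m] with z hz
  obtain ⟨y, hy, hyz⟩ := hz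
  exact ⟨y, hy, hyz.trans (by gcongr)⟩

/-- Differentiability along a set at a density point upgrades to full differentiability under a
one-sided Lipschitz bound. -/
lemma eventually_norm_sub_le_of_differentiableWithinAt {a : EucSp n → EucSp n} {M : ℝ}
    {K : Set (EucSp n)} {x₀ : EucSp n} (hM : 0 ≤ M)
    (hlip : ∀ x ∈ K, ∀ y, ‖a y - a x‖ ≤ M * ‖y - x‖)
    (hdens : ∀ η : ℝ, 0 < η → ∀ᶠ z in 𝓝[≠] x₀, ∃ y ∈ K, ‖y - z‖ ≤ η * ‖z - x₀‖)
    {T : EucSp n →L[ℝ] EucSp n} (hT : HasFDerivWithinAt a T K x₀) {η : ℝ} (hη : 0 < η) :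
    ∀ᶠ z in 𝓝 x₀, ‖a z - a x₀ - T (z - x₀)‖ ≤ η * ‖z - x₀‖ := by
  set c := min 1 (η / (M + 2 + ‖T‖)) with hc
  have hden : 0 < M + 2 + ‖T‖ := by positivity
  have hc0 : 0 < c := by positivity
  have hc1 : c ≤ 1 := min_le_left _ _
  have hc2 : c * (M + 2 + ‖T‖) ≤ η := by
    rw [← le_div_iff₀ hden]; exact min_le_right _ _
  have h1 : ∀ᶠ y in 𝓝[K] x₀, ‖a y - a x₀ - T (y - x₀)‖ ≤ c * ‖y - x₀‖ := hT.isLittleO.def hc0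
  rw [eventually_nhdsWithin_iff] at h1
  obtain ⟨r, hr, hball⟩ := Metric.eventually_nhds_iff_ball.1 h1
  have h2 := hdens c hc0
  rw [eventually_nhdsWithin_iff] at h2
  filter_upwards [h2, Metric.ball_mem_nhds x₀ (half_pos hr)] with z hz hzr
  by_cases hzx : z = x₀
  · simp [hzx]
  obtain ⟨y, hy, hyz⟩ := hz hzx
  rw [mem_ball_iff_norm] at hzr
  have hyx : ‖y - x₀‖ ≤ 2 * ‖z - x₀‖ := by
    calc ‖y - x₀‖ = ‖(y - z) + (z - x₀)‖ := by congr 1; abel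
      _ ≤ ‖y - z‖ + ‖z - x₀‖ := norm_add_le _ _
      _ ≤ 1 * ‖z - x₀‖ + ‖z - x₀‖ := by gcongr; exact hyz.trans (by gcongr)
      _ = _ := by ring
  have h3 := hball y (by rw [mem_ball_iff_norm]; linarith) hy
  have h4 := hlip y hy z
  rw [norm_sub_rev z y] at h4
  have h5 : ‖T (y - z)‖ ≤ ‖T‖ * ‖y - z‖ := T.le_opNorm _
  calc ‖a z - a x₀ - T (z - x₀)‖
      = ‖(a z - a y) + (a y - a x₀ - T (y - x₀)) + T (y - z)‖ := by
        congr 1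
        simp only [map_sub]; abel
    _ ≤ ‖a z - a y‖ + ‖a y - a x₀ - T (y - x₀)‖ + ‖T (y - z)‖ := norm_add₃_le
    _ ≤ M * (c * ‖z - x₀‖) + c * (2 * ‖z - x₀‖) + ‖T‖ * (c * ‖z - x₀‖) := by
        refine add_le_add (add_le_add (h4.trans ?_) (h3.trans ?_)) (h5.trans ?_) <;> gcongr
    _ = c * (M + 2 + ‖T‖) * ‖z - x₀‖ := by ring
    _ ≤ η * ‖z - x₀‖ := by gcongr

/-- A sum of two semiconvex functions with a full ball of supergradients has a contact point at
which both functions have second order expansions. -/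
lemma exists_supergradient_expansion {U W : EucSp n → ℝ} {a b : EucSp n → EucSp n} {L r : ℝ}
    (hL : 0 < L) (hr : 0 < r)
    (hU : ∀ x y, U x + ⟪a x, y - x⟫ - L / 2 * ‖y - x‖ ^ 2 ≤ U y)
    (hW : ∀ x y, W x + ⟪b x, y - x⟫ - L / 2 * ‖y - x‖ ^ 2 ≤ W y)
    (hex : ∀ p : EucSp n, ‖p‖ ≤ r → ∃ x, IsSupergradient (fun y => U y + W y) x p) :
    ∃ (x p : EucSp n) (A B : SymMat n), ‖p‖ ≤ r ∧ IsSupergradient (fun y => U y + W y) x p ∧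
      (∀ η : ℝ, 0 < η → ∀ᶠ y in 𝓝 x, |U y - quadPoly (U x) (a x) A x y| ≤ η * ‖y - x‖ ^ 2) ∧
      (∀ η : ℝ, 0 < η → ∀ᶠ y in 𝓝 x, |W y - quadPoly (W x) (b x) B x y| ≤ η * ‖y - x‖ ^ 2) ∧
      ∀ z, quadForm A z + quadForm B z ≤ 0 := by
  set K : Set (EucSp n) := {x | ∃ p, ‖p‖ ≤ r ∧ IsSupergradient (fun y => U y + W y) x p} with hK
  set μ : MeasureTheory.Measure (EucSp n) :=
    MeasureTheory.Measure.hausdorffMeasure (Module.finrank ℝ (EucSp n) : ℝ) with hμ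
  have hlipa : ∀ x ∈ K, ∀ y, ‖a y - a x‖ ≤ 3 * L * ‖y - x‖ := fun x ⟨p, _, hp⟩ y =>
    norm_subgradient_sub_le hL hU (hp.le_left hL hU hW) y
  have hlipb : ∀ x ∈ K, ∀ y, ‖b y - b x‖ ≤ 3 * L * ‖y - x‖ := fun x ⟨p, _, hp⟩ y => by
    refine norm_subgradient_sub_le hL hW (IsSupergradient.le_left (p := p) hL hW hU ?_) y
    simpa only [add_comm] using hp
  have hLa : LipschitzOnWith (Real.toNNReal (3 * L)) a K := by
    refine LipschitzOnWith.of_dist_le_mul fun x hx y hy => ?_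
    rw [dist_eq_norm, dist_eq_norm, Real.coe_toNNReal _ (by positivity)]
    exact hlipa y hy x
  have hLb : LipschitzOnWith (Real.toNNReal (3 * L)) b K := by
    refine LipschitzOnWith.of_dist_le_mul fun x hx y hy => ?_
    rw [dist_eq_norm, dist_eq_norm, Real.coe_toNNReal _ (by positivity)]
    exact hlipb y hy x
  have hsub : Metric.closedBall (0 : EucSp n) r ⊆ (fun x => a x + b x) '' K := by
    intro p hp
    rw [mem_closedBall_zero_iff] at hp
    obtain ⟨x, hx⟩ := hex p hp
    exact ⟨x, ⟨p, hp, hx⟩, (hx.eq_add hL hU hW).symm⟩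
  have hKpos : μ K ≠ 0 := by
    intro h0
    have h1 := (hLa.add hLb).hausdorffMeasure_image_le
      (d := (Module.finrank ℝ (EucSp n) : ℝ)) (by positivity)
    rw [← hμ, h0, mul_zero] at h1
    have h2 : μ (Metric.closedBall (0 : EucSp n) r) ≤ 0 :=
      (MeasureTheory.measure_mono hsub).trans h1
    exact absurd h2 (not_le.2 (Metric.measure_closedBall_pos μ _ hr))
  obtain ⟨x, ⟨p, hpr, hp⟩, hxa, hxb, hdens⟩ : ∃ x ∈ K, DifferentiableWithinAt ℝ a K x ∧
      DifferentiableWithinAt ℝ b K x ∧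
      ∀ η : ℝ, 0 < η → ∀ᶠ z in 𝓝[≠] x, ∃ y ∈ K, ‖y - z‖ ≤ η * ‖z - x‖ := by
    by_contra hcon
    push Not at hcon
    refine hKpos ?_
    have hae : ∀ᵐ x ∂μ, x ∉ K := by
      filter_upwards [hLa.ae_differentiableWithinAt_of_mem (μ := μ),
        hLb.ae_differentiableWithinAt_of_mem (μ := μ),
        MeasureTheory.ae_imp_of_ae_restrict (ae_eventually_exists_mem_closedBall μ K)]
        with x h1 h2 h3 hx
      obtain ⟨η, hη, h4⟩ := hcon x hx (h1 hx) (h2 hx)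
      exact h4.and_eventually (h3 hx η hη) |>.exists.elim fun z hz => by
        obtain ⟨hz1, y, hy, hz2⟩ := hz
        exact absurd hz2 (not_le.2 (hz1 y hy))
    rw [MeasureTheory.ae_iff] at hae
    simpa using hae
  have hA := fun η (hη : 0 < η) => abs_sub_quadPoly_le_of_subgradient hU (fun η hη =>
    eventually_norm_sub_le_of_differentiableWithinAt (by positivity) hlipa hdens
      hxa.hasFDerivWithinAt hη) hη
  have hB := fun η (hη : 0 < η) => abs_sub_quadPoly_le_of_subgradient hW (fun η hη =>
    eventually_norm_sub_le_of_differentiableWithinAt (by positivity) hlipb hdens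
      hxb.hasFDerivWithinAt hη) hη
  refine ⟨x, p, _, _, hpr, hp, hA, hB, fun z => ?_⟩
  set A := symPart (fderivWithin ℝ a K x)
  set B := symPart (fderivWithin ℝ b K x)
  have hlim : ∀ η : ℝ, 0 < η → (quadForm A z + quadForm B z) / 2 ≤ 2 * η * ‖z‖ ^ 2 := by
    intro η hη
    have ht : Tendsto (fun t : ℝ => x + t • z) (𝓝[>] 0) (𝓝 x) := by
      have : Tendsto (fun t : ℝ => x + t • z) (𝓝 0) (𝓝 (x + (0 : ℝ) • z)) :=
        Continuous.tendsto (by fun_prop) _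
      rw [zero_smul, add_zero] at this
      exact this.mono_left nhdsWithin_le_nhds
    obtain ⟨t, ⟨h1, h2⟩, h3⟩ := (((ht.eventually (hA η hη)).and (ht.eventually (hB η hη))).and
      self_mem_nhdsWithin).exists
    have ht0 : (0 : ℝ) < t := h3
    have h4 := hp (x + t • z)
    simp only [quadPoly, add_sub_cancel_left, quadForm_vec_smul, norm_smul, mul_pow,
      Real.norm_eq_abs, sq_abs] at h1 h2 h4
    rw [hp.eq_add hL hU hW, inner_add_left] at h4
    have h5 := (abs_le.1 h1).1
    have h6 := (abs_le.1 h2).1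
    have h7 : t ^ 2 * ((quadForm A z + quadForm B z) / 2) ≤ t ^ 2 * (2 * η * ‖z‖ ^ 2) := by
      linarith
    exact le_of_mul_le_mul_left h7 (by positivity)
  have ht : Tendsto (fun η : ℝ => 2 * η * ‖z‖ ^ 2) (𝓝[>] 0) (𝓝 0) := by
    have : Tendsto (fun η : ℝ => 2 * η * ‖z‖ ^ 2) (𝓝 0) (𝓝 (2 * 0 * ‖z‖ ^ 2)) :=
      Continuous.tendsto (by fun_prop) _
    rw [mul_zero, zero_mul] at this
    exact this.mono_left nhdsWithin_le_nhds
  have := ge_of_tendsto ht (by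
    filter_upwards [self_mem_nhdsWithin] with η hη using hlim η hη)
  linarith

end

/-- Maximum points of the doubled functional stay in the interior once the penalization is
strong and the tilt small. -/
lemma exists_penalization {C D : Set (EucSp n)} (hC : IsCompact C) (hD : IsOpen D)
    {u w : EucSp n → ℝ} (hu : UpperSemicontinuousOn u C) (hw : UpperSemicontinuousOn w C)
    {x₁ : EucSp n} (hx₁ : x₁ ∈ C) (hlt : ∀ x ∈ C, x ∉ D → u x + w x < u x₁ + w x₁) :
    ∃ L r : ℝ, 0 < L ∧ 0 < r ∧ ∀ x p y z : EucSp n, ‖p‖ ≤ r → y ∈ C → z ∈ C →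
      u x₁ + w x₁ ≤ u y + w z - L / 2 * (‖x - y‖ ^ 2 + ‖x - z‖ ^ 2) + ⟪p, x₁ - x⟫ →
      y ∈ D ∧ z ∈ D := by
  by_contra hcon
  push Not at hcon
  have hcon' : ∀ k : ℕ, ∃ x p y z : EucSp n, ‖p‖ ≤ 1 / ((k : ℝ) + 1) ∧ y ∈ C ∧ z ∈ C ∧
      u x₁ + w x₁ ≤ u y + w z - ((k : ℝ) + 2) / 2 * (‖x - y‖ ^ 2 + ‖x - z‖ ^ 2) +
        ⟪p, x₁ - x⟫ ∧ (y ∈ D → z ∉ D) := fun k => by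
    obtain ⟨x, p, y, z, h1, h2, h3, h4, h5⟩ :=
      hcon ((k : ℝ) + 2) (1 / ((k : ℝ) + 1)) (by positivity) (by positivity)
    exact ⟨x, p, y, z, h1, h2, h3, h4, h5⟩
  choose X P Y Z hP hY hZ hmax hYZ using hcon'
  obtain ⟨yu, _, hyu⟩ := hu.exists_isMaxOn ⟨x₁, hx₁⟩ hC
  obtain ⟨yw, _, hyw⟩ := hw.exists_isMaxOn ⟨x₁, hx₁⟩ hC
  obtain ⟨R, hR⟩ := hC.isBounded.exists_norm_le
  set m := u yu + w yw - (u x₁ + w x₁)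
  have hR0 : 0 ≤ R := (norm_nonneg _).trans (hR _ hx₁)
  have hPk : ∀ k, ‖P k‖ ≤ 1 := fun k => (hP k).trans (by
    rw [div_le_one (by positivity)]; simp)
  have hip : ∀ k, ⟪P k, x₁ - X k⟫ ≤ ‖P k‖ * (2 * R + ‖X k - Y k‖) := fun k => by
    refine (real_inner_le_norm _ _).trans ?_
    gcongr
    calc ‖x₁ - X k‖ = ‖x₁ - Y k - (X k - Y k)‖ := by congr 1; abel
      _ ≤ ‖x₁ - Y k‖ + ‖X k - Y k‖ := norm_sub_le _ _
      _ ≤ (‖x₁‖ + ‖Y k‖) + ‖X k - Y k‖ := by gcongr; exact norm_sub_le _ _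
      _ ≤ 2 * R + ‖X k - Y k‖ := by linarith [hR _ hx₁, hR _ (hY k)]
  have hbd : ∀ k : ℕ, ‖X k - Y k‖ ^ 2 + ‖X k - Z k‖ ^ 2 ≤ (2 * m + 4 * R + 1) * (1 / ((k : ℝ) + 1)) := by
    intro k
    have h1 : u (Y k) ≤ u yu := hyu (hY k)
    have h2 : w (Z k) ≤ w yw := hyw (hZ k)
    have h3 := hip k
    have h4 : ‖P k‖ * (2 * R + ‖X k - Y k‖) ≤ 1 * (2 * R + ‖X k - Y k‖) := by
      gcongr; exact hPk k
    have h5 := hmax k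
    have h6 := sq_nonneg (‖X k - Y k‖ - 1)
    rw [mul_one_div, le_div_iff₀ (by positivity)]
    nlinarith [sq_nonneg ‖X k - Z k‖]
  have hsum : Tendsto (fun k => ‖X k - Y k‖ ^ 2 + ‖X k - Z k‖ ^ 2) atTop (𝓝 0) := by
    refine squeeze_zero (fun k => by positivity) hbd ?_
    simpa using tendsto_one_div_add_atTop_nhds_zero_nat.const_mul (2 * m + 4 * R + 1)
  have hsq : ∀ f : ℕ → EucSp n, (∀ k, ‖f k‖ ^ 2 ≤ ‖X k - Y k‖ ^ 2 + ‖X k - Z k‖ ^ 2) →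
      Tendsto f atTop (𝓝 0) := by
    intro f hf
    rw [tendsto_zero_iff_norm_tendsto_zero]
    have h1 : Tendsto (fun k => ‖f k‖ ^ 2) atTop (𝓝 0) :=
      squeeze_zero (fun k => by positivity) hf hsum
    have h2 := h1.sqrt
    simpa [Real.sqrt_sq] using h2
  have hXY : Tendsto (fun k => X k - Y k) atTop (𝓝 0) := hsq _ fun k => by
    linarith [sq_nonneg ‖X k - Z k‖]
  have hXZ : Tendsto (fun k => X k - Z k) atTop (𝓝 0) := hsq _ fun k => by
    linarith [sq_nonneg ‖X k - Y k‖]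
  obtain ⟨y, hy, σ, hσ, hYy⟩ := hC.tendsto_subseq hY
  have hZy : Tendsto (Z ∘ σ) atTop (𝓝 y) := by
    have := (hYy.add (hXY.comp hσ.tendsto_atTop)).sub (hXZ.comp hσ.tendsto_atTop)
    rw [add_zero, sub_zero] at this
    refine this.congr fun k => ?_
    simp
  have hinner : Tendsto (fun k => ‖P k‖ * (2 * R + ‖X k - Y k‖)) atTop (𝓝 0) := by
    have h1 : Tendsto (fun k => ‖P k‖) atTop (𝓝 0) :=
      squeeze_zero (fun k => norm_nonneg _) hP tendsto_one_div_add_atTop_nhds_zero_nat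
    have h2 := h1.mul (hXY.norm.const_add (2 * R))
    simpa using h2
  have hyD : y ∈ D := by
    by_contra hyD
    have h1 := hlt y hy hyD
    set e := (u x₁ + w x₁ - (u y + w y)) / 4 with he
    have he0 : 0 < e := by simp only [he]; linarith
    have hYC : Tendsto (Y ∘ σ) atTop (𝓝[C] y) :=
      tendsto_nhdsWithin_iff.2 ⟨hYy, Eventually.of_forall fun k => hY _⟩
    have hZC : Tendsto (Z ∘ σ) atTop (𝓝[C] y) :=
      tendsto_nhdsWithin_iff.2 ⟨hZy, Eventually.of_forall fun k => hZ _⟩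
    obtain ⟨k, ⟨h2, h3⟩, h4⟩ := (((hYC.eventually (hu y hy (u y + e) (by linarith))).and
      (hZC.eventually (hw y hy (w y + e) (by linarith)))).and
      ((hinner.comp hσ.tendsto_atTop).eventually (gt_mem_nhds he0))).exists
    have h5 := hmax (σ k)
    have h6 := hip (σ k)
    simp only [Function.comp_apply] at h2 h3 h4
    have h7 : 0 ≤ ((σ k : ℝ) + 2) / 2 * (‖X (σ k) - Y (σ k)‖ ^ 2 + ‖X (σ k) - Z (σ k)‖ ^ 2) := by
      positivity
    linarith
  obtain ⟨k, h1, h2⟩ := ((hYy.eventually (hD.mem_nhds hyD)).and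
    (hZy.eventually (hD.mem_nhds hyD))).exists
  exact hYZ (σ k) h1 h2

/-- The sup-convolution of an upper semicontinuous function, with a choice of maximizers. -/
lemma exists_supConvolution {C : Set (EucSp n)} (hC : IsCompact C) (hne : C.Nonempty)
    {u : EucSp n → ℝ} (hu : UpperSemicontinuousOn u C) (L : ℝ) :
    ∃ Y : EucSp n → EucSp n, ∀ x, Y x ∈ C ∧
      ∀ y ∈ C, u y - L / 2 * ‖x - y‖ ^ 2 ≤ u (Y x) - L / 2 * ‖x - Y x‖ ^ 2 := by
  have : ∀ x, ∃ y ∈ C, ∀ y' ∈ C, u y' - L / 2 * ‖x - y'‖ ^ 2 ≤ u y - L / 2 * ‖x - y‖ ^ 2 := by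
    intro x
    have h1 : UpperSemicontinuousOn (fun y => u y + -(L / 2 * ‖x - y‖ ^ 2)) C :=
      hu.add (Continuous.continuousOn (by fun_prop)).upperSemicontinuousOn
    obtain ⟨y, hy, hmax⟩ := h1.exists_isMaxOn hne hC
    exact ⟨y, hy, fun y' hy' => by simpa [sub_eq_add_neg] using hmax hy'⟩
  choose Y hY using this
  exact ⟨Y, hY⟩

lemma supConvolution_subgradient {C : Set (EucSp n)} {u : EucSp n → ℝ} {L : ℝ}
    {Y : EucSp n → EucSp n} (hY : ∀ x, Y x ∈ C ∧
      ∀ y ∈ C, u y - L / 2 * ‖x - y‖ ^ 2 ≤ u (Y x) - L / 2 * ‖x - Y x‖ ^ 2) (x y : EucSp n) :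
    (u (Y x) - L / 2 * ‖x - Y x‖ ^ 2) + ⟪L • (Y x - x), y - x⟫ - L / 2 * ‖y - x‖ ^ 2 ≤
      u (Y y) - L / 2 * ‖y - Y y‖ ^ 2 := by
  have h1 := (hY y).2 (Y x) (hY x).1
  have e : y - Y x = (y - x) + (x - Y x) := by abel
  rw [e, norm_add_sq_real] at h1
  have h2 : ⟪L • (Y x - x), y - x⟫ = -(L * ⟪y - x, x - Y x⟫) := by
    rw [inner_smul_left, real_inner_comm, ← neg_sub x (Y x), inner_neg_right]; simp
  rw [h2]
  linarith

lemma exists_isSupergradient_supConvolution {C : Set (EucSp n)} (hC : IsCompact C)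
    (hne : C.Nonempty) {u w : EucSp n → ℝ} (hu : UpperSemicontinuousOn u C)
    (hw : UpperSemicontinuousOn w C) {L : ℝ} (hL : 0 < L) {Y Z : EucSp n → EucSp n}
    (hY : ∀ x, Y x ∈ C ∧
      ∀ y ∈ C, u y - L / 2 * ‖x - y‖ ^ 2 ≤ u (Y x) - L / 2 * ‖x - Y x‖ ^ 2)
    (hZ : ∀ x, Z x ∈ C ∧
      ∀ y ∈ C, w y - L / 2 * ‖x - y‖ ^ 2 ≤ w (Z x) - L / 2 * ‖x - Z x‖ ^ 2) (p : EucSp n) :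
    ∃ x, IsSupergradient (fun y => (u (Y y) - L / 2 * ‖y - Y y‖ ^ 2) +
      (w (Z y) - L / 2 * ‖y - Z y‖ ^ 2)) x p := by
  set G : EucSp n × EucSp n → ℝ := fun q =>
    u q.1 + w q.2 + -(L / 4 * ‖q.1 - q.2‖ ^ 2 + ⟪p, q.1 + q.2⟫ / 2) with hG
  have hGu : UpperSemicontinuousOn G (C ×ˢ C) := by
    refine UpperSemicontinuousOn.add (UpperSemicontinuousOn.add ?_ ?_) ?_
    · exact hu.comp continuousOn_fst fun q hq => hq.1
    · exact hw.comp continuousOn_snd fun q hq => hq.2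
    · exact (Continuous.continuousOn (by fun_prop)).upperSemicontinuousOn
  obtain ⟨⟨y, z⟩, ⟨hy, hz⟩, hmax⟩ := hGu.exists_isMaxOn (hne.prod hne) (hC.prod hC)
  have key : ∀ x y z : EucSp n, u y - L / 2 * ‖x - y‖ ^ 2 + (w z - L / 2 * ‖x - z‖ ^ 2) - ⟪p, x⟫ =
      G (y, z) + ‖p‖ ^ 2 / (4 * L) - L * ‖x - (1 / 2 : ℝ) • (y + z) + (1 / (2 * L)) • p‖ ^ 2 := by
    intro x y z
    simp only [hG, ← real_inner_self_eq_norm_sq, inner_add_left, inner_add_right, inner_sub_left,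
      inner_sub_right, inner_smul_left, inner_smul_right, real_inner_comm x y, real_inner_comm x z,
      real_inner_comm x p, real_inner_comm y z, real_inner_comm y p, real_inner_comm z p]
    simp
    field_simp
    ring
  set x := (1 / 2 : ℝ) • (y + z) - (1 / (2 * L)) • p with hx
  refine ⟨x, fun x' => ?_⟩
  have h1 := key x y z
  have h2 := key x' (Y x') (Z x')
  have h3 : G (Y x', Z x') ≤ G (y, z) := hmax ⟨(hY x').1, (hZ x').1⟩
  have h4 := (hY x).2 y hy
  have h5 := (hZ x).2 z hz
  have e0 : x - (1 / 2 : ℝ) • (y + z) + (1 / (2 * L)) • p = 0 := by rw [hx]; abel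
  rw [e0, norm_zero] at h1
  have h6 : 0 ≤ L * ‖x' - (1 / 2 : ℝ) • (Y x' + Z x') + (1 / (2 * L)) • p‖ ^ 2 := by positivity
  rw [inner_sub_right]
  linarith

/-- The theorem on sums for two upper semicontinuous functions whose sum has an interior strict
maximum. -/
theorem exists_jets_of_interior_max {C D : Set (EucSp n)} (hC : IsCompact C) (hD : IsOpen D)
    (hDC : D ⊆ C) {u w : EucSp n → ℝ} (hu : UpperSemicontinuousOn u C)
    (hw : UpperSemicontinuousOn w C) {x₁ : EucSp n} (hx₁ : x₁ ∈ C)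
    (hlt : ∀ x ∈ C, x ∉ D → u x + w x < u x₁ + w x₁) :
    ∃ y ∈ D, ∃ z ∈ D, ∃ (a b : EucSp n) (A B : SymMat n),
      (∀ v, quadForm A v + quadForm B v ≤ 0) ∧
      (∀ δ : ℝ, 0 < δ → ∀ᶠ x in 𝓝 y, u x ≤ quadPoly (u y) a (A + (2 * δ) • 1) y x) ∧
      (∀ δ : ℝ, 0 < δ → ∀ᶠ x in 𝓝 z, w x ≤ quadPoly (w z) b (B + (2 * δ) • 1) z x) := by
  obtain ⟨L, r, hL, hr, hloc⟩ := exists_penalization hC hD hu hw hx₁ hlt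
  have hne : C.Nonempty := ⟨x₁, hx₁⟩
  obtain ⟨Y, hY⟩ := exists_supConvolution hC hne hu L
  obtain ⟨Z, hZ⟩ := exists_supConvolution hC hne hw L
  obtain ⟨x, p, A, B, hp, hxp, hA, hB, hAB⟩ := exists_supergradient_expansion hL hr
    (supConvolution_subgradient hY) (supConvolution_subgradient hZ)
    (fun p _ => exists_isSupergradient_supConvolution hC hne hu hw hL hY hZ p)
  have hin : Y x ∈ D ∧ Z x ∈ D := by
    refine hloc x p (Y x) (Z x) hp (hY x).1 (hZ x).1 ?_
    have h1 := hxp x₁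
    have h2 := (hY x₁).2 x₁ hx₁
    have h3 := (hZ x₁).2 x₁ hx₁
    simp only [sub_self, norm_zero] at h2 h3
    simp only at h1
    linarith
  have transl : ∀ (u : EucSp n → ℝ) (Y : EucSp n → EucSp n) (A : SymMat n) (a : EucSp n),
      (∀ x, Y x ∈ C ∧ ∀ y ∈ C, u y - L / 2 * ‖x - y‖ ^ 2 ≤ u (Y x) - L / 2 * ‖x - Y x‖ ^ 2) →
      Y x ∈ D →
      (∀ η : ℝ, 0 < η → ∀ᶠ y in 𝓝 x, |(u (Y y) - L / 2 * ‖y - Y y‖ ^ 2) -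
        quadPoly (u (Y x) - L / 2 * ‖x - Y x‖ ^ 2) a A x y| ≤ η * ‖y - x‖ ^ 2) →
      ∀ δ : ℝ, 0 < δ → ∀ᶠ z in 𝓝 (Y x), u z ≤ quadPoly (u (Y x)) a (A + (2 * δ) • 1) (Y x) z := by
    intro u Y A a hY hYD hA δ hδ
    have ht : Tendsto (fun z => x + (z - Y x)) (𝓝 (Y x)) (𝓝 x) := by
      have : Tendsto (fun z => x + (z - Y x)) (𝓝 (Y x)) (𝓝 (x + (Y x - Y x))) :=
        Continuous.tendsto (by fun_prop) _
      simpa using this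
    filter_upwards [ht.eventually (hA δ hδ), hD.mem_nhds hYD] with z h1 h2
    have h3 := (hY (x + (z - Y x))).2 z (hDC h2)
    have e : x + (z - Y x) - z = x - Y x := by abel
    rw [e] at h3
    have h4 := (abs_le.1 h1).2
    rw [quadPoly_add_smul_one]
    simp only [quadPoly, add_sub_cancel_left] at h4 ⊢
    linarith
  exact ⟨Y x, hin.1, Z x, hin.2, _, _, A, B, hAB, transl u Y A _ hY hin.1 hA,
    transl w Z B _ hZ hin.2 hB⟩

lemma quadForm_le_of_eventually_le {c : ℝ} {a a' : EucSp n} {A A' : SymMat n} {x₀ : EucSp n}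
    (h : ∀ᶠ x in 𝓝 x₀, quadPoly c a A x₀ x ≤ quadPoly c a' A' x₀ x) (z : EucSp n) :
    quadForm A z ≤ quadForm A' z := by
  have ht : ∀ z : EucSp n, Tendsto (fun t : ℝ => x₀ + t • z) (𝓝[>] 0) (𝓝 x₀) := by
    intro z
    have : Tendsto (fun t : ℝ => x₀ + t • z) (𝓝 0) (𝓝 (x₀ + (0 : ℝ) • z)) :=
      Continuous.tendsto (by fun_prop) _
    rw [zero_smul, add_zero] at this
    exact this.mono_left nhdsWithin_le_nhds
  obtain ⟨t, ⟨h1, h2⟩, h3⟩ := ((((ht z).eventually h).and ((ht (-z)).eventually h)).and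
    self_mem_nhdsWithin).exists
  have ht0 : (0 : ℝ) < t := h3
  simp only [quadPoly, add_sub_cancel_left, quadForm_vec_smul, quadForm_vec_neg, smul_neg,
    inner_neg_right] at h1 h2
  have h4 : t ^ 2 * quadForm A z ≤ t ^ 2 * quadForm A' z := by linarith
  exact le_of_mul_le_mul_left h4 (by positivity)

lemma jetSub_quadPoly {S : Set (SymMat n)}
    (hS : ∀ A ∈ S, ∀ B, (∀ z, quadForm A z ≤ quadForm B z) → B ∈ S) {A : SymMat n} (hA : A ∈ S)
    (c : ℝ) (a x₀ : EucSp n) (X : Set (EucSp n)) :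
    JetSub S X (fun x => (quadPoly c a A x₀ x : ℝ)) := by
  intro y _ c' a' A' hc hev
  have hc' : quadPoly c a A x₀ y = c' := EReal.coe_injective hc
  refine hS A hA A' (quadForm_le_of_eventually_le (c := c') (a := a + symOp A (y - x₀))
    (a' := a') (x₀ := y) ?_)
  filter_upwards [hev] with x hx
  rw [EReal.coe_le_coe_iff, quadPoly_recenter c a A x₀ y, hc'] at hx
  exact hx

lemma ConeSubequation.mem_dualSet_of_quadForm_le (F : ConeSubequation n) {A : SymMat n}
    (hA : A ∈ dualSet F.carrier) (B : SymMat n) (h : ∀ z, quadForm A z ≤ quadForm B z) :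
    B ∈ dualSet F.carrier := fun hB =>
  hA (F.mem_interior_of_quadForm_le hB fun z => by
    rw [quadForm_neg, quadForm_neg]; linarith [h z])

lemma ConeSubequation.neg_mem_dualSet (F : ConeSubequation n) {A : SymMat n}
    (hA : A ∉ F.carrier) : -A ∈ dualSet F.carrier := fun h =>
  hA (interior_subset (by rwa [neg_neg] at h))

lemma coe_toReal_max {a : EReal} (ha : a ≠ ⊤) (c : ℝ) :
    (((max a (c : EReal)).toReal : ℝ) : EReal) = max a c :=
  EReal.coe_toReal (by simp [max_eq_top, ha]) (by simp)

lemma upperSemicontinuousOn_toReal_max {X : Set (EucSp n)} {u : EucSp n → EReal}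
    (hu : UpperSemicontinuousOn u X) (htop : ∀ x ∈ X, u x ≠ ⊤) (c : ℝ) :
    UpperSemicontinuousOn (fun x => (max (u x) (c : EReal)).toReal) X := by
  intro x hx y hy
  have h1 : max (u x) (c : EReal) < (y : EReal) := by
    rw [← coe_toReal_max (htop x hx) c]; exact EReal.coe_lt_coe_iff.2 hy
  filter_upwards [hu x hx y ((le_max_left _ _).trans_lt h1), self_mem_nhdsWithin] with z hz hzX
  have h2 : max (u z) (c : EReal) < (y : EReal) := max_lt hz ((le_max_right _ _).trans_lt h1)
  rw [← coe_toReal_max (htop z hzX) c] at h2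
  exact EReal.coe_lt_coe_iff.1 h2

/-- Comparison principle on a bounded open set. -/
theorem ConeSubequation.comparison (F : ConeSubequation n) {D : Set (EucSp n)} (hD : IsOpen D)
    (hb : Bornology.IsBounded D) {u : EucSp n → EReal} {g : EucSp n → ℝ}
    (hu : UpperSemicontinuousOn u (closure D)) (htop : ∀ x ∈ closure D, u x ≠ ⊤)
    (huF : JetSub F.carrier D u) (hg : LowerSemicontinuousOn g (closure D))
    (hgF : JetSub (dualSet F.carrier) D (fun x => ((-g x : ℝ) : EReal)))
    (hle : ∀ x ∈ frontier D, u x ≤ (g x : EReal)) : ∀ x ∈ closure D, u x ≤ (g x : EReal) := by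
  intro x₁ hx₁
  by_contra hcon
  push Not at hcon
  have hCc : IsCompact (closure D) := hb.isCompact_closure
  obtain ⟨xm, hxm, hmin⟩ := hg.exists_isMinOn ⟨x₁, hx₁⟩ hCc
  set c := g xm
  set u' : EucSp n → ℝ := fun x => (max (u x) (c : EReal)).toReal
  have hu'c : ∀ x ∈ closure D, (u' x : EReal) = max (u x) c := fun x hx =>
    coe_toReal_max (htop x hx) c
  have hu' : UpperSemicontinuousOn u' (closure D) := upperSemicontinuousOn_toReal_max hu htop c
  have hgap : g x₁ < u' x₁ := by
    rw [← EReal.coe_lt_coe_iff, hu'c x₁ hx₁]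
    exact hcon.trans_le (le_max_left _ _)
  obtain ⟨R, hR⟩ := hCc.isBounded.exists_norm_le
  set δ := (u' x₁ - g x₁) / (R ^ 2 + 1) with hδ
  have hδ0 : 0 < δ := div_pos (by linarith) (by positivity)
  have hδR : δ * (R ^ 2 + 1) = u' x₁ - g x₁ := by rw [hδ]; field_simp
  obtain ⟨y, hy, z, hz, a, b, A, B, hAB, hA, hB⟩ := exists_jets_of_interior_max hCc hD
    subset_closure (u := fun x => u' x + δ * ‖x‖ ^ 2) (w := fun x => -g x)
    (hu'.add (Continuous.continuousOn (by fun_prop)).upperSemicontinuousOn)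
    (fun x hx y hy => by
      filter_upwards [hg x hx (-y) (by linarith)] with z hz using by linarith) hx₁ (by
      intro x hx hxD
      have h1 : u' x ≤ g x := by
        rw [← EReal.coe_le_coe_iff, hu'c x hx]
        refine max_le (hle x ?_) (EReal.coe_le_coe_iff.2 (hmin hx))
        rw [hD.frontier_eq]; exact ⟨hx, hxD⟩
      have h2 : ‖x‖ ^ 2 ≤ R ^ 2 := by
        have := hR x hx
        gcongr
      have h3 : δ * ‖x‖ ^ 2 ≤ δ * R ^ 2 := by gcongr
      have h4 : 0 ≤ δ * ‖x₁‖ ^ 2 := by positivity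
      linarith)
  have hBF : B ∈ dualSet F.carrier := mem_of_forall_add_smul_one_mem (isClosed_dualSet _)
    fun η hη => hgF z hz _ b _ rfl (by
      filter_upwards [hB η hη] with x hx using EReal.coe_le_coe_iff.2 hx)
  have hAF : A + (-(2 * δ)) • (1 : SymMat n) ∈ F.carrier := by
    refine mem_of_forall_add_smul_one_mem F.isClosed' fun η hη => ?_
    have h1 : ∀ᶠ x in 𝓝 y, u' x ≤ quadPoly (u' y) (a - (2 * δ) • y)
        (A + (-(2 * δ)) • (1 : SymMat n) + (2 * η) • 1) y x := by
      filter_upwards [hA η hη] with x hx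
      have e : ‖x‖ ^ 2 = ‖y‖ ^ 2 + 2 * ⟪y, x - y⟫ + ‖x - y‖ ^ 2 := by
        rw [← norm_add_sq_real]; congr 2; abel
      have e2 : quadPoly (u' y + δ * ‖y‖ ^ 2) a (A + (2 * η) • 1) y x =
          quadPoly (u' y) (a - (2 * δ) • y) (A + (-(2 * δ)) • (1 : SymMat n) + (2 * η) • 1) y x +
            δ * ‖x‖ ^ 2 := by
        rw [e]
        simp only [quadPoly, quadForm_add, quadForm_smul, quadForm_one, inner_sub_left,
          inner_smul_left]
        simp
        ring
      rw [e2] at hx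
      linarith
    by_cases hc : (c : EReal) ≤ u y
    · refine huF y hy (u' y) (a - (2 * δ) • y) _ ?_ ?_
      · rw [hu'c y (subset_closure hy), max_eq_left hc]
      · filter_upwards [h1, hD.mem_nhds hy] with x hx hxD
        refine le_trans ?_ (EReal.coe_le_coe_iff.2 hx)
        rw [hu'c x (subset_closure hxD)]; exact le_max_left _ _
    · have hy' : u' y = c := by
        apply EReal.coe_injective
        rw [hu'c y (subset_closure hy), max_eq_right (not_le.1 hc).le]
      refine F.mem_of_quadForm_le F.zero_mem (quadForm_le_of_eventually_le (c := u' y) (a := 0)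
        (a' := a - (2 * δ) • y) (x₀ := y) ?_)
      filter_upwards [h1, hD.mem_nhds hy] with x hx hxD
      refine le_trans ?_ hx
      simp only [quadPoly, quadForm_zero, inner_zero_left, hy']
      have : (c : EReal) ≤ u' x := by rw [hu'c x (subset_closure hxD)]; exact le_max_right _ _
      have := EReal.coe_le_coe_iff.1 this
      linarith
  refine hBF (F.mem_interior_of_quadForm_add_le hAF (δ := 2 * δ) (by positivity) fun v => ?_)
  rw [quadForm_add, quadForm_smul, quadForm_one, quadForm_neg]
  linarith [hAB v]

/-- Comparison with quadratic polynomials. -/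
lemma ConeSubequation.le_quadPoly (F : ConeSubequation n) {D : Set (EucSp n)} (hD : IsOpen D)
    (hb : Bornology.IsBounded D) {u : EucSp n → EReal}
    (hu : UpperSemicontinuousOn u (closure D)) (htop : ∀ x ∈ closure D, u x ≠ ⊤)
    (huF : JetSub F.carrier D u) {c : ℝ} {a x₀ : EucSp n} {A : SymMat n} (hA : A ∉ F.carrier)
    (hle : ∀ x ∈ frontier D, u x ≤ (quadPoly c a A x₀ x : ℝ)) :
    ∀ x ∈ closure D, u x ≤ (quadPoly c a A x₀ x : ℝ) := by
  refine F.comparison hD hb hu htop huF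
    (continuous_quadPoly c a A x₀).continuousOn.lowerSemicontinuousOn ?_ hle
  have h1 : ∀ x, -quadPoly c a A x₀ x = quadPoly (-c) (-a) (-A) x₀ x := by
    intro x; simp only [quadPoly, quadForm_neg, inner_neg_left]; ring
  simp only [h1]
  exact jetSub_quadPoly (fun A hA B => F.mem_dualSet_of_quadForm_le hA B) (F.neg_mem_dualSet hA)
    _ _ _ _

lemma quadPoly_smul (t c : ℝ) (a : EucSp n) (A : SymMat n) (x₀ x : EucSp n) :
    quadPoly (t * c) (t • a) (t • A) x₀ x = t * quadPoly c a A x₀ x := by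
  simp only [quadPoly, quadForm_smul, real_inner_smul_left]; ring

lemma quadPoly_neg (c : ℝ) (a : EucSp n) (A : SymMat n) (x₀ x : EucSp n) :
    quadPoly (-c) (-a) (-A) x₀ x = -quadPoly c a A x₀ x := by
  simp only [quadPoly, quadForm_neg, inner_neg_left]; ring

lemma quadPoly_add_const (c d : ℝ) (a : EucSp n) (A : SymMat n) (x₀ x : EucSp n) :
    quadPoly (c + d) a A x₀ x = quadPoly c a A x₀ x + d := by
  simp only [quadPoly]; ring

lemma EReal.add_coe_le_coe_iff (a : EReal) (C b : ℝ) :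
    a + (C : EReal) ≤ (b : EReal) ↔ a ≤ ((b - C : ℝ) : EReal) := by
  induction a with
  | bot => simp
  | top =>
    rw [EReal.top_add_coe]
    exact ⟨fun h => absurd (top_le_iff.1 h) (EReal.coe_ne_top _),
      fun h => absurd (top_le_iff.1 h) (EReal.coe_ne_top _)⟩
  | coe a => norm_cast; constructor <;> intro h <;> linarith

/-- Upper semicontinuous functions on the closure of `Ω`, with values in `[-∞, ∞)`, which are
viscosity subsolutions in `Ω`. -/
structure SubOn (F : ConeSubequation n) (Ω : Set (EucSp n)) (v : EucSp n → EReal) : Prop where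
  usc : UpperSemicontinuousOn v (closure Ω)
  ne_top : ∀ y ∈ closure Ω, v y ≠ ⊤
  jet : JetSub F.carrier Ω v

lemma JetSub.add_coe {S : Set (SymMat n)} {X : Set (EucSp n)} {u : EucSp n → EReal}
    (h : JetSub S X u) (C : ℝ) : JetSub S X (fun y => u y + (C : EReal)) := by
  intro x₀ hx₀ c a A hc hev
  refine h x₀ hx₀ (c - C) a A ?_ ?_
  · induction hu : u x₀ with
    | bot => simp [hu] at hc
    | top => simp [hu] at hc
    | coe b => simp only [hu] at hc; norm_cast at hc ⊢; linarith
  · filter_upwards [hev] with x hx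
    rw [EReal.add_coe_le_coe_iff] at hx
    rwa [sub_eq_add_neg c C, quadPoly_add_const, ← sub_eq_add_neg]

lemma SubOn.add_coe {F : ConeSubequation n} {Ω : Set (EucSp n)} {v : EucSp n → EReal}
    (h : SubOn F Ω v) (C : ℝ) : SubOn F Ω (fun y => v y + (C : EReal)) := by
  refine ⟨fun y hy => ?_, fun y hy => ?_, h.jet.add_coe C⟩
  · refine ContinuousAt.comp_upperSemicontinuousWithinAt (g := fun a : EReal => a + (C : EReal))
      ?_ (h.usc y hy) (fun a b hab => add_le_add_left hab _)
    exact (EReal.continuousAt_add (p := (v y, (C : EReal))) (by simp) (by simp)).comp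
      (f := fun a : EReal => (a, (C : EReal))) (by fun_prop)
  · exact EReal.add_ne_top (h.ne_top y hy) (EReal.coe_ne_top _)

lemma SubOn.mono {F : ConeSubequation n} {Ω Ω' : Set (EucSp n)} {v : EucSp n → EReal}
    (h : SubOn F Ω v) (hΩ : Ω' ⊆ Ω) : SubOn F Ω' v :=
  ⟨h.usc.mono (closure_mono hΩ), fun y hy => h.ne_top y (closure_mono hΩ hy), h.jet.mono hΩ⟩

/-- The maximum of `u` and a quadratic polynomial inside a ball, and `u` outside of it. -/
def glueQuad (u : EucSp n → EReal) (c : ℝ) (a : EucSp n) (A : SymMat n) (x₀ : EucSp n) (r : ℝ)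
    (y : EucSp n) : EReal :=
  if dist y x₀ < r then max (u y) (quadPoly c a A x₀ y : ℝ) else u y

lemma le_glueQuad (u : EucSp n → EReal) (c : ℝ) (a : EucSp n) (A : SymMat n) (x₀ : EucSp n)
    (r : ℝ) (y : EucSp n) : u y ≤ glueQuad u c a A x₀ r y := by
  unfold glueQuad; split_ifs <;> simp

lemma quadPoly_le_glueQuad (u : EucSp n → EReal) (c : ℝ) (a : EucSp n) (A : SymMat n)
    {x₀ y : EucSp n} {r : ℝ} (hy : dist y x₀ < r) :
    (quadPoly c a A x₀ y : ℝ) ≤ glueQuad u c a A x₀ r y := by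
  unfold glueQuad; rw [if_pos hy]; exact le_max_right _ _

lemma SubOn.glueQuad {F : ConeSubequation n} {Ω : Set (EucSp n)} {u : EucSp n → EReal}
    (hu : SubOn F Ω u) {A : SymMat n} (hA : A ∈ F.carrier) (c : ℝ) (a x₀ : EucSp n) {r s : ℝ}
    (hsr : s < r)
    (hq : ∀ y ∈ closure Ω, s < dist y x₀ → dist y x₀ < r → (quadPoly c a A x₀ y : ℝ) ≤ u y) :
    SubOn F Ω (glueQuad u c a A x₀ r) := by
  refine ⟨fun y hy z hz => ?_, fun y hy => ?_, fun y hy c' a' A' hc' hev => ?_⟩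
  · have h1 := (le_glueQuad u c a A x₀ r y).trans_lt hz
    by_cases hd : dist y x₀ < r
    · have h2 := (quadPoly_le_glueQuad u c a A hd).trans_lt hz
      have h3 : ∀ᶠ y' in 𝓝 y, ((quadPoly c a A x₀ y' : ℝ) : EReal) < z :=
        (continuous_coe_real_ereal.comp (continuous_quadPoly c a A x₀)).continuousAt.eventually
          (gt_mem_nhds h2)
      filter_upwards [hu.usc y hy z h1, h3.filter_mono nhdsWithin_le_nhds] with y' h4 h5
      unfold _root_.glueQuad
      split_ifs
      · exact max_lt h4 h5
      · exact h4
    · have h3 : ∀ᶠ y' in 𝓝 y, s < dist y' x₀ :=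
        (continuous_id.dist continuous_const).continuousAt.eventually
          (lt_mem_nhds (hsr.trans_le (not_lt.1 hd)))
      filter_upwards [hu.usc y hy z h1, h3.filter_mono nhdsWithin_le_nhds,
        self_mem_nhdsWithin] with y' h4 h5 h6
      unfold _root_.glueQuad
      split_ifs with h7
      · rwa [max_eq_left (hq y' h6 h5 h7)]
      · exact h4
  · unfold _root_.glueQuad
    split_ifs
    · simp [max_eq_top, hu.ne_top y hy]
    · exact hu.ne_top y hy
  · by_cases hw : _root_.glueQuad u c a A x₀ r y = u y
    · refine hu.jet y hy c' a' A' (hw ▸ hc') ?_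
      filter_upwards [hev] with z hz
      exact (le_glueQuad u c a A x₀ r z).trans hz
    · have hd : dist y x₀ < r := by
        by_contra hd
        exact hw (by unfold _root_.glueQuad; rw [if_neg hd])
      have hw' : _root_.glueQuad u c a A x₀ r y = (quadPoly c a A x₀ y : ℝ) := by
        unfold _root_.glueQuad at hw ⊢
        rw [if_pos hd] at hw ⊢
        exact (max_choice _ _).resolve_left hw
      refine jetSub_quadPoly (fun A hA B h => F.mem_of_quadForm_le hA h) hA c a x₀ Set.univ y
        trivial c' a' A' (hw'.symm.trans hc') ?_
      have hd' : ∀ᶠ z in 𝓝 y, dist z x₀ < r := Metric.isOpen_ball.mem_nhds hd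
      filter_upwards [hev, hd'] with z hz hz'
      exact (quadPoly_le_glueQuad u c a A hz').trans hz

/-- The upper semicontinuous envelope of `f` relative to the set `K`. -/
def uscEnv (K : Set (EucSp n)) (f : EucSp n → EReal) (y : EucSp n) : EReal :=
  limsup f (𝓝[K] y)

lemma le_uscEnv {K : Set (EucSp n)} (f : EucSp n → EReal) {y : EucSp n} (hy : y ∈ K) :
    f y ≤ uscEnv K f y := by
  refine le_limsup_of_frequently_le' fun h => ?_
  exact (mem_of_mem_nhdsWithin hy h) le_rfl

lemma uscEnv_le {K : Set (EucSp n)} {f : EucSp n → EReal} {y : EucSp n} (hy : y ∈ K)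
    {g : EucSp n → EReal} (hg : ContinuousWithinAt g K y) (h : ∀ᶠ z in 𝓝[K] y, f z ≤ g z) :
    uscEnv K f y ≤ g y := by
  have : (𝓝[K] y).NeBot := nhdsWithin_neBot_of_mem hy
  exact (limsup_le_limsup h).trans hg.limsup_eq.le

lemma upperSemicontinuousOn_uscEnv (K : Set (EucSp n)) (f : EucSp n → EReal) :
    UpperSemicontinuousOn (uscEnv K f) K := by
  intro y hy z hz
  obtain ⟨z', h1, h2⟩ := exists_between hz
  have h3 : ∀ᶠ w in 𝓝[K] y, f w < z' := eventually_lt_of_limsup_lt h1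
  filter_upwards [eventually_eventually_nhdsWithin.2 h3] with w hw
  exact (limsup_le_of_le (h := hw.mono fun _ h => h.le)).trans_lt h2

/-- The upper envelope of a family of subsolutions is a subsolution. -/
lemma jetSub_uscEnv_iSup {F : ConeSubequation n} {Ω : Set (EucSp n)} (hΩ : IsOpen Ω)
    {𝓥 : Set (EucSp n → EReal)} (h𝓥 : ∀ v ∈ 𝓥, SubOn F Ω v) :
    JetSub F.carrier Ω (uscEnv (closure Ω) fun y => ⨆ v ∈ 𝓥, v y) := by
  intro x₀ hx₀ c a A hc hev
  refine mem_of_forall_add_smul_one_mem F.isClosed' fun δ hδ => ?_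
  by_contra hA
  obtain ⟨r, hr, hball⟩ := Metric.nhds_basis_closedBall.mem_iff.1
    (inter_mem (hΩ.mem_nhds hx₀) hev)
  set q := quadPoly (c + -(δ * r ^ 2)) a (A + (2 * δ) • (1 : SymMat n)) x₀ with hq
  have h1 : ∀ y ∈ Metric.ball x₀ r, (⨆ v ∈ 𝓥, v y) ≤ (q y : EReal) := by
    intro y hy
    refine iSup₂_le fun v hv => ?_
    have hsub : Metric.ball x₀ r ⊆ Ω := fun z hz =>
      (hball (Metric.ball_subset_closedBall hz)).1
    have hv' := (h𝓥 v hv).mono hsub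
    refine F.le_quadPoly Metric.isOpen_ball Metric.isBounded_ball hv'.usc hv'.ne_top hv'.jet hA
      ?_ y (subset_closure hy)
    intro z hz
    have hz' : dist z x₀ = r := Metric.frontier_ball_subset_sphere hz
    have hz2 := hball (Metric.mem_closedBall.2 hz'.le)
    have h2 : v z ≤ (quadPoly c a A x₀ z : ℝ) := by
      refine le_trans (le_trans ?_ (le_uscEnv _ (subset_closure hz2.1))) hz2.2
      exact le_iSup₂ (f := fun v (_ : v ∈ 𝓥) => v z) v hv
    rw [quadPoly_add_const, quadPoly_add_smul_one, ← dist_eq_norm, hz']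
    simpa using h2
  have h2 : uscEnv (closure Ω) (fun y => ⨆ v ∈ 𝓥, v y) x₀ ≤ (q x₀ : EReal) := by
    refine uscEnv_le (subset_closure hx₀) (g := fun y => (q y : EReal)) ?_ ?_
    · exact (continuous_coe_real_ereal.comp (continuous_quadPoly _ a _ x₀)).continuousWithinAt
    · exact Filter.Eventually.filter_mono nhdsWithin_le_nhds
        (by filter_upwards [Metric.ball_mem_nhds x₀ hr] with y hy using h1 y hy)
  rw [hc, hq, quadPoly_self, EReal.coe_le_coe_iff] at h2
  nlinarith [mul_pos hδ (pow_pos hr 2)]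

lemma JetSub.neg_smul_add {F : ConeSubequation n} {X : Set (EucSp n)} {g : EucSp n → ℝ}
    (h : JetSub (dualSet F.carrier) X (fun y => ((-g y : ℝ) : EReal))) {θ : ℝ} (hθ : 0 < θ)
    (d : ℝ) : JetSub (dualSet F.carrier) X (fun y => ((-(θ * g y + d) : ℝ) : EReal)) := by
  intro x₀ hx₀ c a A hc hev
  have hc' : -(θ * g x₀ + d) = c := EReal.coe_injective hc
  have h1 := h x₀ hx₀ (θ⁻¹ * (c + d)) (θ⁻¹ • a) (θ⁻¹ • A) (by
    rw [← hc', EReal.coe_eq_coe_iff]; field_simp; ring) (by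
    filter_upwards [hev] with x hx
    rw [EReal.coe_le_coe_iff] at hx ⊢
    rw [quadPoly_smul, quadPoly_add_const, le_inv_mul_iff₀ hθ]
    linarith)
  have h2 := F.smul_mem_dualSet h1 hθ
  rwa [smul_smul, mul_inv_cancel₀ hθ.ne', one_smul] at h2

/-- Comparison in the presence of finitely many poles of the supersolution, at which the
subsolution exceeds the supersolution by at most a constant. -/
theorem ConeSubequation.comparison_of_poles (F : ConeSubequation n) {W P : Set (EucSp n)}
    (hW : IsOpen W) (hb : Bornology.IsBounded W) (hP : P.Finite) (hPW : P ⊆ W)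
    {v : EucSp n → EReal} (hv : SubOn F W v) {g : EucSp n → ℝ}
    (hg : LowerSemicontinuousOn g (closure W \ P))
    (hgF : JetSub (dualSet F.carrier) (W \ P) (fun y => ((-g y : ℝ) : EReal))) {M : ℝ}
    (hM : ∀ y ∈ closure W, v y ≤ (M : EReal)) (hle : ∀ y ∈ frontier W, v y ≤ (g y : EReal))
    (hpole : ∀ p ∈ P, (∃ C : ℝ, ∀ᶠ y in 𝓝[≠] p, v y ≤ ((g y + C : ℝ) : EReal)) ∧
      Tendsto g (𝓝[≠] p) atBot) :
    ∀ y ∈ closure W \ P, v y ≤ (g y : EReal) := by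
  intro y₀ hy₀
  have key : ∀ θ : ℝ, 0 < θ → θ < 1 → v y₀ ≤ ((θ * g y₀ + (1 - θ) * M : ℝ) : EReal) := by
    intro θ hθ hθ1
    set g' : EucSp n → ℝ := fun y => θ * g y + (1 - θ) * M with hg'
    have h1 : ∀ p ∈ P, ∃ s : ℝ, 0 < s ∧ Metric.closedBall p s ⊆ W ∩ {y₀}ᶜ ∧
        ∀ y ∈ Metric.closedBall p s, y ≠ p → v y ≤ (g' y : EReal) := by
      intro p hp
      obtain ⟨⟨C, hC⟩, hlim⟩ := hpole p hp
      have h2 : ∀ᶠ y in 𝓝[≠] p, v y ≤ (g' y : EReal) := by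
        filter_upwards [hC, hlim.eventually_le_atBot (M - C / (1 - θ))] with y hy1 hy2
        refine hy1.trans (EReal.coe_le_coe_iff.2 ?_)
        have h3 : (1 - θ) * g y ≤ (1 - θ) * (M - C / (1 - θ)) :=
          mul_le_mul_of_nonneg_left hy2 (by linarith)
        rw [mul_sub, mul_div_cancel₀ _ (by linarith : (1 - θ) ≠ 0)] at h3
        simp only [hg']; linarith
      have h3 : W ∩ {y₀}ᶜ ∈ 𝓝 p := inter_mem (hW.mem_nhds (hPW hp))
        (isOpen_compl_singleton.mem_nhds fun h => hy₀.2 (h ▸ hp))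
      obtain ⟨s, hs, hs'⟩ := Metric.nhds_basis_closedBall.mem_iff.1
        (inter_mem h3 (eventually_nhdsWithin_iff.1 h2))
      exact ⟨s, hs, fun y hy => (hs' hy).1, fun y hy hne => (hs' hy).2 hne⟩
    choose! s hs hsW hsv using h1
    set B : Set (EucSp n) := ⋃ p ∈ P, Metric.closedBall p (s p)
    have hB : IsClosed B := hP.isClosed_biUnion fun p _ => Metric.isClosed_closedBall
    set D := Bᶜ ∩ W
    have hD : IsOpen D := hB.isOpen_compl.inter hW
    have hDW : D ⊆ W := Set.inter_subset_right
    have hcl : closure D ⊆ closure W \ P := by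
      refine fun y hy => ⟨closure_mono hDW hy, fun hyP => ?_⟩
      obtain ⟨z, hz1, hz2⟩ := mem_closure_iff.1 hy _ Metric.isOpen_ball
        (Metric.mem_ball_self (hs y hyP))
      exact hz2.1 (Set.mem_biUnion hyP (Metric.ball_subset_closedBall hz1))
    have hDP : D ⊆ W \ P := fun y hy => ⟨hy.2, (hcl (subset_closure hy)).2⟩
    have hvD := hv.mono hDW
    refine F.comparison hD (hb.subset hDW) hvD.usc hvD.ne_top hvD.jet (g := g') ?_
      ((hgF.mono hDP).neg_smul_add hθ _) ?_ y₀ ?_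
    · intro y hy z hz
      have h2 : (z - (1 - θ) * M) / θ < g y := by
        rw [div_lt_iff₀ hθ]; simp only [hg'] at hz; linarith
      filter_upwards [(hg.mono hcl) y hy _ h2] with w hw
      rw [gt_iff_lt, div_lt_iff₀ hθ] at hw; simp only [hg']; linarith
    · intro y hy
      rw [hD.frontier_eq] at hy
      have hyc := hcl hy.1
      by_cases hyW : y ∈ W
      · have : y ∈ B := by_contra fun h => hy.2 ⟨h, hyW⟩
        obtain ⟨p, hp, hyp⟩ := Set.mem_iUnion₂.1 this
        exact hsv p hp y hyp fun h => hyc.2 (h ▸ hp)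
      · have h2 := hle y (by rw [hW.frontier_eq]; exact ⟨hyc.1, hyW⟩)
        have h3 := hM y hyc.1
        induction hvy : v y with
        | bot => exact bot_le
        | top => exact absurd hvy (hv.ne_top y hyc.1)
        | coe b =>
          rw [hvy, EReal.coe_le_coe_iff] at h2 h3
          rw [EReal.coe_le_coe_iff]
          simp only [hg']; nlinarith
    · refine hB.isOpen_compl.inter_closure ⟨fun h => ?_, hy₀.1⟩
      obtain ⟨p, hp, hyp⟩ := Set.mem_iUnion₂.1 h
      exact (hsW p hp hyp).2 rfl
  have hlim : Tendsto (fun θ : ℝ => ((θ * g y₀ + (1 - θ) * M : ℝ) : EReal)) (𝓝[<] 1)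
      (𝓝 (((1 : ℝ) * g y₀ + (1 - (1 : ℝ)) * M : ℝ) : EReal)) := by
    refine Tendsto.mono_left (Continuous.tendsto ?_ _) nhdsWithin_le_nhds
    exact continuous_coe_real_ereal.comp (by fun_prop)
  rw [show (1 : ℝ) * g y₀ + (1 - 1) * M = g y₀ by ring] at hlim
  refine ge_of_tendsto hlim ?_
  filter_upwards [self_mem_nhdsWithin, Ioo_mem_nhdsLT (zero_lt_one' ℝ)] with θ _ hθ
  exact key θ hθ.1 hθ.2

lemma quadForm_of_coe_eq_proj_mul {B M : SymMat n} {e : EucSp n}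
    (h : (B : Matrix (Fin n) (Fin n) ℝ) = (1 - projMat e) * M * (1 - projMat e)) (z : EucSp n) :
    quadForm B z = quadForm M (z - ⟪e, z⟫ • e) := by
  have hP : ∀ w : EucSp n, symOp (symProj e) w = ⟪e, w⟫ • e := by
    intro w
    ext i
    rw [symOp_apply]
    simp [symProj, projMat, PiLp.inner_apply, Finset.sum_mul]
    exact Finset.sum_congr rfl fun j _ => by ring
  have hB : ∀ w : EucSp n, symOp B w
      = symOp M (w - ⟪e, w⟫ • e) - ⟪e, symOp M (w - ⟪e, w⟫ • e)⟫ • e := by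
    intro w
    have h1 : symOp B = (1 - symOp (symProj e)) * symOp M * (1 - symOp (symProj e)) := by
      simp only [symOp]
      rw [h, map_mul, map_mul, map_sub, map_one]
      rfl
    rw [h1, mul_apply_eq_comp, mul_apply_eq_comp, sub_apply, sub_apply, one_apply_eq_self,
      one_apply_eq_self, hP, hP]
  rw [quadForm, quadForm, hB, inner_sub_right, inner_smul_right, inner_sub_left,
    real_inner_smul_left, real_inner_comm z e]
  ring

lemma quadForm_proj_le (M : SymMat n) {e : EucSp n} (he : ‖e‖ = 1) (z : EucSp n) {δ : ℝ}
    (hδ : 0 < δ) :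
    quadForm M (z - ⟪e, z⟫ • e) ≤ quadForm M z
      + (3 * ‖symOp M‖ + ‖symOp M‖ ^ 2 / δ) * ⟪e, z⟫ ^ 2 + δ * ‖z‖ ^ 2 := by
  set s := ⟪e, z⟫
  set m := ‖symOp M‖
  have hm : 0 ≤ m := norm_nonneg _
  have h1 : quadForm M (z - s • e) = quadForm M z - 2 * s * ⟪symOp M z, e⟫ + s ^ 2 * quadForm M e := by
    rw [sub_eq_add_neg, ← neg_smul, quadForm_vec_add, quadForm_vec_smul, inner_smul_right]; ring
  have h2 : quadForm M e ≤ m := by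
    have := (le_abs_self _).trans (abs_quadForm_le M e)
    rwa [he, one_pow, mul_one] at this
  have h3 : |⟪symOp M z, e⟫| ≤ m * ‖z‖ := by
    refine (abs_real_inner_le_norm _ _).trans ?_
    rw [he, mul_one]; exact (symOp M).le_opNorm z
  have h4 : -(2 * s * ⟪symOp M z, e⟫) ≤ 2 * |s| * (m * ‖z‖) := by
    refine (neg_le_abs _).trans ?_
    rw [abs_mul, abs_mul, abs_two]
    gcongr
  have h5 : 2 * |s| * (m * ‖z‖) ≤ m ^ 2 / δ * s ^ 2 + δ * ‖z‖ ^ 2 := by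
    have : 0 ≤ (m * |s| / δ - ‖z‖) ^ 2 * δ := by positivity
    have h6 : (m * |s| / δ - ‖z‖) ^ 2 * δ
        = m ^ 2 / δ * |s| ^ 2 - 2 * |s| * (m * ‖z‖) + δ * ‖z‖ ^ 2 := by
      field_simp; ring
    rw [sq_abs] at h6
    linarith
  have h6 : s ^ 2 * quadForm M e ≤ s ^ 2 * m := by gcongr
  rw [h1]
  nlinarith [mul_nonneg hm (sq_nonneg s)]

lemma sub_le_sub_mul_sq {K G m μ s p p₀ : ℝ} (hK : 0 < K) (hG : 0 < G) (hm : 0 < m)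
    (hs : 0 ≤ s) (hs1 : s ≤ 1) (hs2 : s ≤ 1 / (2 * K * (G + m)))
    (hs3 : s ≤ μ / (4 * (K * m ^ 2) + 1)) (hp : |p| ≤ G * s) (hp₀ : |p₀| ≤ m * s ^ 2)
    (hpp : p₀ ≤ p) : p₀ - μ / 4 * s ^ 2 ≤ p - K * p ^ 2 := by
  have h7 : s ^ 2 ≤ s := by nlinarith
  have h8 : K * (p + p₀) ≤ 1 := by
    have h9 : p + p₀ ≤ (G + m) * s := by
      have := mul_le_mul_of_nonneg_left h7 hm.le
      linarith [(abs_le.1 hp).2, (abs_le.1 hp₀).2]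
    rw [le_div_iff₀ (by positivity)] at hs2
    have h10 := mul_le_mul_of_nonneg_left h9 hK.le
    have h11 : 0 ≤ K * ((G + m) * s) := by positivity
    linarith
  have h9 : p₀ - K * p₀ ^ 2 ≤ p - K * p ^ 2 := by
    nlinarith [mul_nonneg (sub_nonneg.2 hpp) (sub_nonneg.2 h8)]
  have h10 : K * p₀ ^ 2 ≤ μ / 4 * s ^ 2 := by
    have h11 : p₀ ^ 2 ≤ (m * s ^ 2) ^ 2 := by
      rw [← sq_abs p₀]; gcongr
    have h12 : K * p₀ ^ 2 ≤ K * m ^ 2 * s ^ 2 * s ^ 2 := by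
      have := mul_le_mul_of_nonneg_left h11 hK.le
      linarith
    have h13 : K * m ^ 2 * s ^ 2 ≤ μ / 4 := by
      rw [le_div_iff₀ (by positivity)] at hs3
      have := mul_le_mul_of_nonneg_left h7 (show 0 ≤ K * m ^ 2 by positivity)
      linarith
    exact h12.trans (mul_le_mul_of_nonneg_right h13 (sq_nonneg _))
  linarith

/-- A strictly `F`-convex boundary admits local quadratic barriers: `A ∉ F` makes the polynomial
a strict supersolution and `-A ∈ F` makes its negative a subsolution. -/
lemma StrictlyConvexBoundary.exists_barrier {F : ConeSubequation n} (hF3 : CondF3 F)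
    {Ω : Set (EucSp n)} (h : StrictlyConvexBoundary F Ω) {x₀ : EucSp n} (hx₀ : x₀ ∈ frontier Ω) :
    ∃ (a : EucSp n) (A : SymMat n) (c r : ℝ), 0 < c ∧ 0 < r ∧ A ∉ F.carrier ∧ -A ∈ F.carrier ∧
      ∀ y ∈ closure Ω, dist y x₀ < r → c * dist y x₀ ^ 2 ≤ quadPoly 0 a A x₀ y := by
  obtain ⟨ρ, hρ, hΩ, hb⟩ := h
  obtain ⟨hg, t₀, ht₀⟩ := hb x₀ hx₀
  have hΩo : IsOpen Ω := by rw [hΩ]; exact isOpen_lt hρ.continuous continuous_const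
  have hcl : ∀ y ∈ closure Ω, ρ y ≤ 0 := by
    intro y hy
    refine closure_minimal (s := Ω) (t := {y | ρ y ≤ 0}) ?_
      (isClosed_le hρ.continuous continuous_const) hy
    rw [hΩ]; exact fun z (hz : ρ z < 0) => hz.le
  rw [hΩo.frontier_eq] at hx₀
  have hρ0 : ρ x₀ = 0 := by
    refine le_antisymm (hcl _ hx₀.1) ?_
    have := hx₀.2
    rw [hΩ] at this
    exact not_lt.1 this
  obtain ⟨M, hM, hT⟩ := exists_taylor_quadPoly (f := ρ) (x₀ := x₀)
    ((hρ.of_le (by norm_cast)).contDiffAt)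
  set g := gradient ρ x₀ with hgdef
  set G := ‖g‖ with hG
  have hG0 : 0 < G := norm_pos_iff.2 hg
  set ν := innerNormal ρ x₀ with hν
  have hν1 : ‖ν‖ = 1 := by
    simp only [hν, innerNormal, norm_neg, norm_smul, norm_inv, norm_norm]
    exact inv_mul_cancel₀ hG0.ne'
  have hgν : ∀ z, ⟪g, z⟫ = -(G * ⟪ν, z⟫) := by
    intro z
    simp only [hν, innerNormal, inner_neg_left, real_inner_smul_left]
    rw [← hgdef, ← hG]; field_simp
  -- the convexity condition, as a quadratic form inequality
  obtain ⟨B₀, hB₀, hB₀'⟩ := ht₀ t₀ le_rfl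
  have hB₀q : ∀ z, G * quadForm B₀ z
      = quadForm M (z - ⟪ν, z⟫ • ν) + G * t₀ * ⟪ν, z⟫ ^ 2 := by
    intro z
    have h1 : ((G • (B₀ - t₀ • symProj ν) : SymMat n) : Matrix (Fin n) (Fin n) ℝ)
        = (1 - projMat ν) * M * (1 - projMat ν) := by
      have h2 : ((G • (B₀ - t₀ • symProj ν) : SymMat n) : Matrix (Fin n) (Fin n) ℝ)
        = G • ((B₀ : Matrix (Fin n) (Fin n) ℝ) - t₀ • projMat ν) := rfl
      rw [h2, hB₀', hM, secondFF, add_sub_cancel_right, smul_smul, ← hgdef, ← hG,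
        mul_inv_cancel₀ hG0.ne', one_smul]
    have h3 := quadForm_of_coe_eq_proj_mul h1 z
    rw [quadForm_smul, quadForm_sub, quadForm_smul, quadForm_symProj] at h3
    linarith
  obtain ⟨δ₀, hδ₀, hB₁⟩ := F.exists_sub_smul_one_mem hB₀
  set L₁ := 3 * ‖symOp M‖ + ‖symOp M‖ ^ 2 / (G * δ₀) + G * t₀ with hL₁
  have hconv : ∀ L ≥ L₁, ∀ μ, μ ≤ G * δ₀ / 2 →
      M + L • symProj ν - (2 * μ) • (1 : SymMat n) ∈ F.carrier := by
    intro L hL μ hμ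
    refine F.mem_of_quadForm_le (F.f2 _ (interior_subset hB₁) G hG0) fun z => ?_
    have h1 := quadForm_proj_le M hν1 z (mul_pos hG0 hδ₀)
    have h2 := hB₀q z
    simp only [quadForm_smul, quadForm_sub, quadForm_add, quadForm_one, quadForm_symProj]
    have h3 : L₁ * ⟪ν, z⟫ ^ 2 ≤ L * ⟪ν, z⟫ ^ 2 := by gcongr
    have h4 : μ * ‖z‖ ^ 2 ≤ G * δ₀ / 2 * ‖z‖ ^ 2 := by gcongr
    rw [hL₁] at h3
    nlinarith
  -- condition (F3), for perturbations of large multiples of the projection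
  have hF : ∀ᶠ t : ℝ in 𝓝[>] 0, -symProj ν + (2 * t) • (-M + (2 : ℝ) • (1 : SymMat n)) ∉ F.carrier := by
    have h1 : Tendsto (fun t : ℝ => -symProj ν + (2 * t) • (-M + (2 : ℝ) • (1 : SymMat n))) (𝓝[>] 0)
        (𝓝 (-symProj ν + (2 * 0 : ℝ) • (-M + (2 : ℝ) • (1 : SymMat n)))) :=
      Tendsto.mono_left ((continuous_add_smul_symMat _ _).tendsto _) nhdsWithin_le_nhds
    rw [mul_zero, zero_smul, add_zero] at h1
    exact h1.eventually (F.isClosed'.isOpen_compl.mem_nhds (hF3 ν hν1))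
  obtain ⟨t, ht, ht0, htL⟩ := (hF.and (Ioo_mem_nhdsGT
    (show (0 : ℝ) < (2 * (|L₁| + 1))⁻¹ by positivity))).exists
  set L := (2 * t)⁻¹ with hL
  have hL0 : 0 < L := by positivity
  have hLL : L₁ ≤ L := by
    have h1 : 2 * t * (2 * (|L₁| + 1)) ≤ 2 := by
      have := mul_le_mul_of_nonneg_right htL.le (show 0 ≤ 2 * (|L₁| + 1) by positivity)
      rw [inv_mul_cancel₀ (by positivity)] at this
      linarith
    have h2 : |L₁| + 1 ≤ L := by
      rw [hL, le_inv_comm₀ (by positivity) (by positivity), ← one_div, le_div_iff₀ (by positivity)]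
      linarith
    linarith [le_abs_self L₁]
  set μ := min 1 (G * δ₀ / 2) with hμ
  have hμ0 : 0 < μ := lt_min one_pos (by positivity)
  set A : SymMat n := -M - L • symProj ν + (2 * μ) • (1 : SymMat n) with hA
  have hq : ∀ z, quadForm A z = -quadForm M z - L * ⟪ν, z⟫ ^ 2 + 2 * μ * ‖z‖ ^ 2 := by
    intro z
    simp only [hA, quadForm_smul, quadForm_sub, quadForm_add, quadForm_one, quadForm_symProj,
      quadForm_neg]
  set K := L / (2 * G ^ 2) with hK
  have hK0 : 0 < K := by positivity
  set m := ‖symOp M‖ + μ with hm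
  have hm0 : 0 < m := by positivity
  obtain ⟨r₁, hr₁, hball⟩ := Metric.nhds_basis_ball.mem_iff.1 (hT (μ / 4) (by positivity))
  set r := min (min r₁ 1) (min (1 / (2 * K * (G + m))) (μ / (4 * (K * m ^ 2) + 1))) with hr
  have hr0 : 0 < r := by positivity
  refine ⟨-g, A, μ / 2, r, by positivity, hr0, ?_, ?_, ?_⟩
  · intro hAF
    refine ht (F.mem_of_quadForm_le (F.f2 A hAF (2 * t) (by positivity)) fun z => ?_)
    rw [quadForm_smul, hq]
    simp only [quadForm_smul, quadForm_add, quadForm_one, quadForm_symProj, quadForm_neg]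
    have h1 : 2 * t * L = 1 := mul_inv_cancel₀ (by positivity)
    have h2 : 2 * t * (2 * μ * ‖z‖ ^ 2) ≤ 2 * t * (2 * 1 * ‖z‖ ^ 2) := by
      gcongr; exact min_le_left _ _
    have h3 : 2 * t * (L * ⟪ν, z⟫ ^ 2) = ⟪ν, z⟫ ^ 2 := by rw [← mul_assoc, h1, one_mul]
    linarith
  · have : -A = M + L • symProj ν - (2 * μ) • (1 : SymMat n) := by rw [hA]; abel
    rw [this]; exact hconv L hLL μ (min_le_right _ _)
  · intro y hy hyr
    set z := y - x₀ with hz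
    rw [dist_eq_norm] at hyr ⊢
    have hr1 : ‖z‖ < r₁ := hyr.trans_le ((min_le_left _ _).trans (min_le_left _ _))
    have hr2 : ‖z‖ ≤ 1 := hyr.le.trans ((min_le_left _ _).trans (min_le_right _ _))
    have hr3 : ‖z‖ ≤ 1 / (2 * K * (G + m)) :=
      hyr.le.trans ((min_le_right _ _).trans (min_le_left _ _))
    have hr4 : ‖z‖ ≤ μ / (4 * (K * m ^ 2) + 1) :=
      hyr.le.trans ((min_le_right _ _).trans (min_le_right _ _))
    have hz0 : 0 ≤ ‖z‖ := norm_nonneg z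
    have h1 : |ρ y - quadPoly (ρ x₀) g M x₀ y| ≤ μ / 4 * ‖y - x₀‖ ^ 2 :=
      hball (by rw [Metric.mem_ball, dist_eq_norm]; exact hr1)
    rw [hρ0] at h1
    have h2 := (abs_le.1 h1).1
    have h3 := hcl y hy
    simp only [quadPoly, zero_add, inner_neg_left] at h2 ⊢
    rw [← hz] at h2 ⊢
    rw [hq]
    set p := -⟪g, z⟫ with hp
    set p₀ := quadForm M z / 2 - μ / 4 * ‖z‖ ^ 2 with hp₀
    have h4 : p₀ ≤ p := by rw [hp, hp₀]; linarith
    have h5 : |p| ≤ G * ‖z‖ := by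
      rw [hp, abs_neg]; exact abs_real_inner_le_norm _ _
    have h6 : |p₀| ≤ m * ‖z‖ ^ 2 := by
      have h7 := abs_le.1 (abs_quadForm_le M z)
      have h8 : 0 ≤ μ * ‖z‖ ^ 2 := by positivity
      have h9 : 0 ≤ ‖symOp M‖ * ‖z‖ ^ 2 := by positivity
      rw [abs_le, hm, hp₀, add_mul]
      constructor <;> linarith [h7.1, h7.2]
    have h10 := sub_le_sub_mul_sq hK0 hG0 hm0 hz0 hr2 hr3 hr4 h5 h6 h4
    have h11 : L * ⟪ν, z⟫ ^ 2 = 2 * (K * p ^ 2) := by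
      rw [hp, hgν, hK]; field_simp
    rw [h11]
    linarith

/-- Subsolutions bounded by `M₀` on the boundary of a bounded domain are uniformly bounded. -/
lemma exists_bound_of_le_frontier (F : ConeSubequation n) {Ω : Set (EucSp n)} (hΩ : IsOpen Ω)
    (hb : Bornology.IsBounded Ω) (M₀ : ℝ) : ∃ M : ℝ, ∀ v, SubOn F Ω v →
      (∀ y ∈ frontier Ω, v y ≤ (M₀ : EReal)) → ∀ y ∈ closure Ω, v y ≤ (M : EReal) := by
  obtain ⟨R, hR⟩ := hb.closure.subset_closedBall 0
  have hA : (0 : SymMat n) + (2 * (-1) : ℝ) • (1 : SymMat n) ∉ F.carrier := by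
    have : (0 : SymMat n) + (2 * (-1) : ℝ) • (1 : SymMat n) = -((2 : ℝ) • (1 : SymMat n)) := by
      rw [zero_add, mul_neg_one, neg_smul]
    rw [this]; exact F.neg_smul_one_notMem two_pos
  have hq : ∀ y : EucSp n,
      quadPoly (M₀ + R ^ 2) 0 ((0 : SymMat n) + (2 * (-1) : ℝ) • (1 : SymMat n)) 0 y
        = M₀ + R ^ 2 - ‖y‖ ^ 2 := by
    intro y
    rw [quadPoly_add_smul_one]
    simp [quadPoly, quadForm_zero]; ring
  refine ⟨M₀ + R ^ 2, fun v hv hle y hy => ?_⟩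
  refine (F.le_quadPoly hΩ hb hv.usc hv.ne_top hv.jet hA (c := M₀ + R ^ 2) (a := 0) (x₀ := 0)
    (fun z hz => (hle z hz).trans (EReal.coe_le_coe_iff.2 ?_)) y hy).trans
    (EReal.coe_le_coe_iff.2 ?_)
  · have h1 : ‖z‖ ≤ R := by simpa using hR (frontier_subset_closure hz)
    rw [hq]; nlinarith [norm_nonneg z]
  · rw [hq]; nlinarith [norm_nonneg y]

/-- The real-valued function underlying a downward-pointing singular harmonic of polar type. -/
lemma DPSingular.toReal_spec {F : ConeSubequation n} {U : Set (EucSp n)} {p : EucSp n}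
    {h : EucSp n → EReal} (hh : DPSingular F U p h) (hpol : h p = ⊥) :
    (∀ y ∈ U \ {p}, ((h y).toReal : EReal) = h y) ∧
      ContinuousOn (fun y => (h y).toReal) (U \ {p}) ∧
      JetSub (dualSet F.carrier) (U \ {p}) (fun y => ((-(h y).toReal : ℝ) : EReal)) ∧
      Tendsto (fun y => (h y).toReal) (𝓝[≠] p) atBot := by
  have h1 : ∀ y ∈ U \ {p}, h y ≠ ⊥ := fun y hy =>
    ((hpol ▸ hh.strictMin y hy.1 hy.2 : ⊥ < h y)).ne'
  have h2 : ∀ y ∈ U \ {p}, ((h y).toReal : EReal) = h y := fun y hy =>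
    EReal.coe_toReal (hh.subh.2.1 y hy.1) (h1 y hy)
  refine ⟨h2, ?_, ?_, ?_⟩
  · intro y hy
    exact (EReal.tendsto_toReal (hh.subh.2.1 y hy.1) (h1 y hy)).comp
      ((hh.cont y hy.1).mono Set.sdiff_subset)
  · refine JetSub.congr (hh.isOpen'.sdiff isClosed_singleton) hh.harm.2.jetSub fun y hy => ?_
    rw [EReal.coe_neg, h2 y hy]
  · rw [tendsto_atBot]
    intro b
    have h3 : Tendsto h (𝓝 p) (𝓝 ⊥) := by
      rw [← hpol]; exact (hh.cont p hh.mem).continuousAt (hh.isOpen'.mem_nhds hh.mem)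
    have h4 := (EReal.tendsto_nhds_bot_iff_real.1 h3 b).filter_mono
      (nhdsWithin_le_nhds (s := {p}ᶜ))
    have h5 : ∀ᶠ y in 𝓝[≠] p, y ∈ U := nhdsWithin_le_nhds (hh.isOpen'.mem_nhds hh.mem)
    filter_upwards [h4, h5, self_mem_nhdsWithin] with y h6 h7 h8
    rw [← h2 y ⟨h7, h8⟩, EReal.coe_lt_coe_iff] at h6
    exact h6.le

/-- Near a pole, all bounded subsolutions with at least the singularity of `h` are bounded above
by `h` plus a common constant. -/
lemma DPSingular.exists_uniform_bound {F : ConeSubequation n} {U Ω : Set (EucSp n)} {p : EucSp n}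
    {h : EucSp n → EReal} (hh : DPSingular F U p h) (hpol : h p = ⊥) (hΩ : IsOpen Ω)
    (hp : p ∈ Ω) (M : ℝ) : ∃ C : ℝ, ∃ r : ℝ, 0 < r ∧ Metric.closedBall p r ⊆ Ω ∩ U ∧
      ∀ v, SubOn F Ω v → (∀ y ∈ closure Ω, v y ≤ (M : EReal)) →
        (∃ C' : ℝ, ∀ᶠ y in 𝓝[≠] p, v y ≤ h y + (C' : EReal)) →
        ∀ y ∈ Metric.ball p r, y ≠ p → v y ≤ h y + (C : EReal) := by
  obtain ⟨h1, h2, h3, h4⟩ := hh.toReal_spec hpol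
  obtain ⟨r, hr, hball⟩ := Metric.nhds_basis_closedBall.mem_iff.1
    (inter_mem (hΩ.mem_nhds hp) (hh.isOpen'.mem_nhds hh.mem))
  have hne : ∀ y ∈ Metric.sphere p r, y ≠ p := fun y hy hyp => by
    rw [hyp, Metric.mem_sphere, dist_self] at hy; exact hr.ne hy
  have hsph : Metric.sphere p r ⊆ U \ {p} := fun y hy =>
    ⟨(hball (Metric.sphere_subset_closedBall hy)).2, hne y hy⟩
  obtain ⟨m, hm⟩ := (isCompact_sphere p r).bddBelow_image (h2.mono hsph)
  refine ⟨M - m, r, hr, hball, fun v hv hvM hvC y hy hyp => ?_⟩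
  have hb : Metric.ball p r ⊆ Ω := fun z hz => (hball (Metric.ball_subset_closedBall hz)).1
  have hcb : closure (Metric.ball p r) \ {p} ⊆ U \ {p} := fun z hz =>
    ⟨(hball (Metric.closure_ball_subset_closedBall hz.1)).2, hz.2⟩
  have h5 := F.comparison_of_poles (W := Metric.ball p r) (P := {p}) (M := M)
    (g := fun y => 1 * (h y).toReal + (M - m)) Metric.isOpen_ball
    Metric.isBounded_ball (Set.finite_singleton p) (by simpa using hr) (hv.mono hb)
    (ContinuousOn.lowerSemicontinuousOn (by have := h2.mono hcb; fun_prop))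
    ((h3.mono (fun z hz => hcb ⟨subset_closure hz.1, hz.2⟩)).neg_smul_add one_pos _)
    (fun z hz => hvM z (closure_mono hb hz)) ?_ ?_ y ⟨subset_closure hy, hyp⟩
  · rw [one_mul, EReal.coe_add, h1 y (hcb ⟨subset_closure hy, hyp⟩)] at h5
    exact h5
  · intro z hz
    have hz' := Metric.frontier_ball_subset_sphere hz
    refine (hvM z (closure_mono hb (frontier_subset_closure hz))).trans
      (EReal.coe_le_coe_iff.2 ?_)
    linarith [hm (Set.mem_image_of_mem _ hz')]
  · rintro q rfl
    obtain ⟨C', hC'⟩ := hvC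
    refine ⟨⟨C' - (M - m), ?_⟩, ?_⟩
    · have h6 : ∀ᶠ y in 𝓝[≠] q, y ∈ U := nhdsWithin_le_nhds (hh.isOpen'.mem_nhds hh.mem)
      filter_upwards [hC', h6, self_mem_nhdsWithin] with z hz hz1 hz2
      rw [← h1 z ⟨hz1, hz2⟩, ← EReal.coe_add] at hz
      refine hz.trans (EReal.coe_le_coe_iff.2 (by linarith))
    · simp only [one_mul]
      exact tendsto_atBot_add_const_right _ _ h4

/-- The Perron family with boundary values `φ` and poles `x j`, with singularities `h j`. -/
structure MemPerron (F : ConeSubequation n) (Ω : Set (EucSp n)) (φ : EucSp n → ℝ) {k : ℕ}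
    (x : Fin k → EucSp n) (h : Fin k → EucSp n → EReal) (v : EucSp n → EReal) : Prop where
  subOn : SubOn F Ω v
  le_boundary : ∀ z ∈ frontier Ω, v z ≤ (φ z : EReal)
  le_pole : ∀ j, ∃ C : ℝ, ∀ᶠ z in 𝓝[≠] (x j), v z ≤ h j z + (C : EReal)

/-- The Perron function. -/
def perron (F : ConeSubequation n) (Ω : Set (EucSp n)) (φ : EucSp n → ℝ) {k : ℕ}
    (x : Fin k → EucSp n) (h : Fin k → EucSp n → EReal) (y : EucSp n) : EReal :=
  ⨆ v ∈ {v | MemPerron F Ω φ x h v}, v y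

section

variable {F : ConeSubequation n} {Ω : Set (EucSp n)} {φ : EucSp n → ℝ} {k : ℕ}
  {x : Fin k → EucSp n} {h : Fin k → EucSp n → EReal}

lemma MemPerron.le_perron {v : EucSp n → EReal} (hv : MemPerron F Ω φ x h v) (y : EucSp n) :
    v y ≤ perron F Ω φ x h y :=
  le_iSup₂ (f := fun v (_ : v ∈ {v | MemPerron F Ω φ x h v}) => v y) v hv

lemma perron_le {y : EucSp n} {b : EReal} (hb : ∀ v, MemPerron F Ω φ x h v → v y ≤ b) :
    perron F Ω φ x h y ≤ b :=
  iSup₂_le hb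

/-- Glueing a quadratic subsolution into a member of the Perron family, away from the poles. -/
lemma MemPerron.glueQuad {u : EucSp n → EReal} (hu : MemPerron F Ω φ x h u) {A : SymMat n}
    (hA : A ∈ F.carrier) {c : ℝ} {a x₀ : EucSp n} {r s : ℝ} (hsr : s < r)
    (hq : ∀ y ∈ closure Ω, s < dist y x₀ → dist y x₀ < r → (quadPoly c a A x₀ y : ℝ) ≤ u y)
    (hx : ∀ j, r < dist (x j) x₀)
    (hφ : ∀ y ∈ frontier Ω, dist y x₀ < r → quadPoly c a A x₀ y ≤ φ y) :
    MemPerron F Ω φ x h (glueQuad u c a A x₀ r) := by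
  refine ⟨hu.subOn.glueQuad hA c a x₀ hsr hq, fun z hz => ?_, fun j => ?_⟩
  · unfold _root_.glueQuad
    split_ifs with hd
    · exact max_le (hu.le_boundary z hz) (EReal.coe_le_coe_iff.2 (hφ z hz hd))
    · exact hu.le_boundary z hz
  · obtain ⟨C, hC⟩ := hu.le_pole j
    have h1 : ∀ᶠ z in 𝓝 (x j), r < dist z x₀ :=
      (continuous_id.dist continuous_const).continuousAt.eventually (lt_mem_nhds (hx j))
    refine ⟨C, ?_⟩
    filter_upwards [hC, h1.filter_mono nhdsWithin_le_nhds] with z hz1 hz2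
    unfold _root_.glueQuad
    rwa [if_neg hz2.not_gt]

/-- The upper barrier: the Perron function has upper limit at most `φ` at the boundary. -/
lemma uscEnv_perron_le (hΩ : IsOpen Ω) (hb : Bornology.IsBounded Ω) {M : ℝ}
    (hM : ∀ v, MemPerron F Ω φ x h v → ∀ y ∈ closure Ω, v y ≤ (M : EReal))
    (hφ : ContinuousOn φ (frontier Ω)) {x₀ : EucSp n} (hx₀ : x₀ ∈ frontier Ω)
    (hbar : ∃ (a : EucSp n) (A : SymMat n) (c r : ℝ), 0 < c ∧ 0 < r ∧ A ∉ F.carrier ∧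
      -A ∈ F.carrier ∧
      ∀ y ∈ closure Ω, dist y x₀ < r → c * dist y x₀ ^ 2 ≤ quadPoly 0 a A x₀ y) :
    uscEnv (closure Ω) (perron F Ω φ x h) x₀ ≤ (φ x₀ : EReal) := by
  obtain ⟨a, A, c, r, hc, hr, hA, -, hq⟩ := hbar
  refine EReal.le_of_forall_lt_iff_le.1 fun b hb' => ?_
  rw [EReal.coe_lt_coe_iff] at hb'
  obtain ⟨r₁, hr₁, hφr⟩ := Metric.mem_nhdsWithin_iff.1 ((hφ x₀ hx₀).eventually (gt_mem_nhds hb'))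
  set s := min r r₁ / 2 with hs
  have hmin : 0 < min r r₁ := lt_min hr hr₁
  have hs0 : 0 < s := by positivity
  have hsr : s < r := (half_lt_self hmin).trans_le (min_le_left _ _)
  have hsr₁ : s < r₁ := (half_lt_self hmin).trans_le (min_le_right _ _)
  set K := (|M - b| + 1) / (c * s ^ 2) with hK
  have hK0 : 0 < K := by positivity
  have hKA : K • A ∉ F.carrier := fun hmem => hA (by
    have := F.f2 _ hmem K⁻¹ (inv_pos.2 hK0)
    rwa [smul_smul, inv_mul_cancel₀ hK0.ne', one_smul] at this)
  set Q := quadPoly (K * 0 + b) (K • a) (K • A) x₀ with hQ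
  have hQq : ∀ y, Q y = K * quadPoly 0 a A x₀ y + b := fun y => by
    rw [hQ, quadPoly_add_const, quadPoly_smul]
  have hball : closure (Metric.ball x₀ s) ⊆ Metric.closedBall x₀ s :=
    Metric.closure_ball_subset_closedBall
  have key : ∀ v, MemPerron F Ω φ x h v →
      ∀ y ∈ closure (Metric.ball x₀ s ∩ Ω), v y ≤ (Q y : EReal) := by
    intro v hv
    have hv' := hv.subOn.mono (Ω' := Metric.ball x₀ s ∩ Ω) Set.inter_subset_right
    refine F.le_quadPoly (Metric.isOpen_ball.inter hΩ) (hb.subset Set.inter_subset_right) hv'.usc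
      hv'.ne_top hv'.jet hKA ?_
    intro y hy
    have hyc := frontier_subset_closure hy
    have hyΩ : y ∈ closure Ω := closure_mono Set.inter_subset_right hyc
    have hyd : dist y x₀ ≤ s := hball (closure_mono Set.inter_subset_left hyc)
    have hqy := hq y hyΩ (hyd.trans_lt hsr)
    have hqy0 : 0 ≤ c * dist y x₀ ^ 2 := by positivity
    by_cases hyf : y ∈ Ω
    · have hys : dist y x₀ = s := by
        refine hyd.antisymm (not_lt.1 fun hlt => ?_)
        rw [(Metric.isOpen_ball.inter hΩ).frontier_eq] at hy
        exact hy.2 ⟨hlt, hyf⟩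
      refine (hM v hv y hyΩ).trans (EReal.coe_le_coe_iff.2 ?_)
      change M ≤ Q y
      rw [hQq]
      rw [hys] at hqy
      have h1 := mul_le_mul_of_nonneg_left hqy hK0.le
      rw [hK, div_mul_cancel₀ _ (by positivity)] at h1
      rw [hK]
      linarith [le_abs_self (M - b)]
    · have hyfr : y ∈ frontier Ω := by rw [hΩ.frontier_eq]; exact ⟨hyΩ, hyf⟩
      refine (hv.le_boundary y hyfr).trans (EReal.coe_le_coe_iff.2 ?_)
      change φ y ≤ Q y
      have h1 : φ y < b := hφr ⟨hyd.trans_lt hsr₁, hyfr⟩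
      rw [hQq]
      nlinarith [mul_nonneg hK0.le (hqy0.trans hqy)]
  have hQ0 : Q x₀ = b := by rw [hQq, quadPoly_self]; ring
  rw [← hQ0]
  refine uscEnv_le (g := fun y => (Q y : EReal)) (frontier_subset_closure hx₀) ?_ ?_
  · exact (continuous_coe_real_ereal.comp (continuous_quadPoly _ _ _ x₀)).continuousWithinAt
  · filter_upwards [mem_nhdsWithin_of_mem_nhds (Metric.ball_mem_nhds x₀ hs0),
      self_mem_nhdsWithin] with y hy1 hy2
    exact perron_le fun v hv => key v hv y (Metric.isOpen_ball.inter_closure ⟨hy1, hy2⟩)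

/-- The lower barrier: the Perron function has lower limit at least `φ` at the boundary. -/
lemma uscEnv_neg_perron_le {ψ : EucSp n → EReal} (hψ : MemPerron F Ω φ x h ψ)
    (hψc : ContinuousOn ψ (closure Ω)) (hφ : ContinuousOn φ (frontier Ω)) {x₀ : EucSp n}
    (hx₀ : x₀ ∈ frontier Ω) (hψx : ψ x₀ ≠ ⊥) (hx : ∀ j, x j ≠ x₀)
    (hbar : ∃ (a : EucSp n) (A : SymMat n) (c r : ℝ), 0 < c ∧ 0 < r ∧ A ∉ F.carrier ∧
      -A ∈ F.carrier ∧
      ∀ y ∈ closure Ω, dist y x₀ < r → c * dist y x₀ ^ 2 ≤ quadPoly 0 a A x₀ y) :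
    uscEnv (closure Ω) (fun y => -perron F Ω φ x h y) x₀ ≤ -(φ x₀ : EReal) := by
  obtain ⟨a, A, c, r, hc, hr, -, hA, hq⟩ := hbar
  have hcl := frontier_subset_closure hx₀
  rw [← EReal.coe_neg]
  refine EReal.le_of_forall_lt_iff_le.1 fun b hb' => ?_
  rw [EReal.coe_lt_coe_iff] at hb'
  obtain ⟨r₁, hr₁, hφr⟩ := Metric.mem_nhdsWithin_iff.1
    ((hφ x₀ hx₀).eventually (lt_mem_nhds (show -b < φ x₀ by linarith)))
  obtain ⟨N, hN1, hN⟩ := EReal.exists_between_coe_real (bot_lt_iff_ne_bot.2 hψx)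
  obtain ⟨r₂, hr₂, hψr⟩ := Metric.mem_nhdsWithin_iff.1
    ((hψc x₀ hcl).eventually (lt_mem_nhds hN))
  have hxev : ∀ᶠ ρ : ℝ in 𝓝[>] 0, ∀ j, ρ < dist (x j) x₀ :=
    Filter.eventually_all.2 fun j => nhdsWithin_le_nhds (gt_mem_nhds (dist_pos.2 (hx j)))
  obtain ⟨s, ⟨hsx, hs0, hs1⟩⟩ := (hxev.and (Ioo_mem_nhdsGT
    (lt_min hr (lt_min hr₁ hr₂)))).exists
  have hsr : s < r := hs1.trans_le (min_le_left _ _)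
  have hsr₁ : s < r₁ := hs1.trans_le ((min_le_right _ _).trans (min_le_left _ _))
  have hsr₂ : s < r₂ := hs1.trans_le ((min_le_right _ _).trans (min_le_right _ _))
  set K := (|-b - N| + 1) / (c * (s / 2) ^ 2) with hK
  have hK0 : 0 < K := by positivity
  set Q := quadPoly (K * (-0) + -b) (K • (-a)) (K • (-A)) x₀ with hQ
  have hQq : ∀ y, Q y = -(K * quadPoly 0 a A x₀ y) - b := fun y => by
    rw [hQ, quadPoly_add_const, quadPoly_smul, quadPoly_neg]; ring
  have hglue := hψ.glueQuad (F.f2 _ hA K hK0) (c := K * (-0) + -b) (a := K • (-a)) (x₀ := x₀)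
    (r := s) (s := s / 2) (half_lt_self hs0) ?_ hsx ?_
  · have hQ0 : Q x₀ = -b := by rw [hQq, quadPoly_self]; ring
    have hQ1 : (fun y => ((-Q y : ℝ) : EReal)) x₀ = b := by
      change ((-Q x₀ : ℝ) : EReal) = b
      rw [hQ0, neg_neg]
    rw [← hQ1]
    refine uscEnv_le (g := fun y => ((-Q y : ℝ) : EReal)) hcl ?_ ?_
    · exact (continuous_coe_real_ereal.comp
        (continuous_quadPoly _ _ _ x₀).neg).continuousWithinAt
    · filter_upwards [mem_nhdsWithin_of_mem_nhds (Metric.ball_mem_nhds x₀ hs0)] with y hy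
      rw [EReal.coe_neg, EReal.neg_le_neg_iff]
      exact (quadPoly_le_glueQuad ψ _ _ _ hy).trans (hglue.le_perron y)
  · intro y hy hy1 hy2
    refine le_trans (EReal.coe_le_coe_iff.2 ?_) (hψr ⟨hy2.trans hsr₂, hy⟩ : (N : EReal) < ψ y).le
    change Q y ≤ N
    have h1 : c * (s / 2) ^ 2 ≤ quadPoly 0 a A x₀ y :=
      le_trans (by gcongr) (hq y hy (hy2.trans hsr))
    have h2 := mul_le_mul_of_nonneg_left h1 hK0.le
    rw [hQq]
    have h3 : K * (c * (s / 2) ^ 2) = |-b - N| + 1 := by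
      rw [hK, div_mul_cancel₀ _ (by positivity)]
    linarith [le_abs_self (-b - N)]
  · intro y hy hy1
    change Q y ≤ φ y
    have h1 : -b < φ y := hφr ⟨hy1.trans hsr₁, hy⟩
    have h2 : 0 ≤ quadPoly 0 a A x₀ y :=
      le_trans (by positivity) (hq y (frontier_subset_closure hy) (hy1.trans hsr))
    rw [hQq]
    nlinarith [mul_nonneg hK0.le h2]

/-- The bump argument: if the usc envelope of the Perron function lies in the Perron family, then
minus the lsc envelope is a subsolution of the dual equation away from the poles. -/
lemma jetSub_uscEnv_neg_perron (hΩ : IsOpen Ω)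
    (hS : MemPerron F Ω φ x h (uscEnv (closure Ω) (perron F Ω φ x h))) :
    JetSub (dualSet F.carrier) (Ω \ Set.range x)
      (uscEnv (closure Ω) (fun y => -perron F Ω φ x h y)) := by
  intro x₀ hx₀ c a A hc hev
  by_contra hA
  have hA' : -A ∈ interior F.carrier := not_not.1 hA
  obtain ⟨δ, hδ, hAδ⟩ := F.exists_sub_smul_one_mem hA'
  have hopen : IsOpen (Ω \ Set.range x) := hΩ.sdiff (Set.finite_range x).isClosed
  obtain ⟨r, hr, hball⟩ := Metric.nhds_basis_closedBall.mem_iff.1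
    (inter_mem (hopen.mem_nhds hx₀) hev)
  set Q := quadPoly (-c + δ * (r / 2) ^ 2) (-a) (-A + (2 * (-δ)) • (1 : SymMat n)) x₀ with hQ
  have hQq : ∀ y, Q y = -quadPoly c a A x₀ y + δ * (r / 2) ^ 2 - δ * dist y x₀ ^ 2 := fun y => by
    rw [hQ, quadPoly_add_smul_one, quadPoly_add_const, quadPoly_neg, dist_eq_norm]; ring
  have hAδ' : -A + (2 * (-δ)) • (1 : SymMat n) ∈ F.carrier := by
    have : -A + (2 * (-δ)) • (1 : SymMat n) = -A - (2 * δ) • (1 : SymMat n) := by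
      rw [mul_neg, neg_smul, sub_eq_add_neg]
    rw [this]; exact interior_subset hAδ
  have hglue := hS.glueQuad hAδ' (c := -c + δ * (r / 2) ^ 2) (a := -a) (x₀ := x₀)
    (r := r) (s := r / 2) (half_lt_self hr) ?_ ?_ ?_
  · have h1 : uscEnv (closure Ω) (fun y => -perron F Ω φ x h y) x₀
        ≤ (fun y => ((-Q y : ℝ) : EReal)) x₀ := by
      refine uscEnv_le (g := fun y => ((-Q y : ℝ) : EReal)) (subset_closure hx₀.1) ?_ ?_
      · exact (continuous_coe_real_ereal.comp
          (continuous_quadPoly _ _ _ x₀).neg).continuousWithinAt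
      · filter_upwards [mem_nhdsWithin_of_mem_nhds (Metric.ball_mem_nhds x₀ hr)] with y hy
        rw [EReal.coe_neg, EReal.neg_le_neg_iff]
        exact (quadPoly_le_glueQuad _ _ _ _ hy).trans (hglue.le_perron y)
    rw [hc] at h1
    have h2 := EReal.coe_le_coe_iff.1 h1
    rw [hQ, quadPoly_self] at h2
    nlinarith [mul_pos hδ (pow_pos (half_pos hr) 2)]
  · intro y hy hy1 hy2
    have h1 : uscEnv (closure Ω) (fun y => -perron F Ω φ x h y) y
        ≤ (quadPoly c a A x₀ y : EReal) := (hball (Metric.mem_closedBall.2 hy2.le)).2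
    have h2 : -perron F Ω φ x h y ≤ (quadPoly c a A x₀ y : EReal) :=
      (le_uscEnv (fun y => -perron F Ω φ x h y) hy).trans h1
    refine le_trans ?_ (le_uscEnv _ hy)
    rw [EReal.neg_le, ← EReal.coe_neg] at h2
    refine le_trans (EReal.coe_le_coe_iff.2 ?_) h2
    change Q y ≤ _
    rw [hQq]
    have : (r / 2) ^ 2 ≤ dist y x₀ ^ 2 := by gcongr
    nlinarith
  · intro j
    by_contra hj
    exact (hball (Metric.mem_closedBall.2 (not_lt.1 hj))).1.2 ⟨j, rfl⟩
  · intro y hy hy1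
    rw [hΩ.frontier_eq] at hy
    exact absurd (hball (Metric.mem_closedBall.2 hy1.le)).1.1 hy.2

end

lemma memPerron_iff {F : ConeSubequation n} {Ω : Set (EucSp n)} (hΩ : IsOpen Ω)
    {φ : EucSp n → ℝ} {k : ℕ} {x : Fin k → EucSp n} {h : Fin k → EucSp n → EReal}
    {v : EucSp n → EReal} : MemPerron F Ω φ x h v ↔
      UpperSemicontinuousOn v (closure Ω) ∧ (∀ z ∈ closure Ω, v z ≠ ⊤) ∧
        FSubharmonicOn F.carrier Ω v ∧ (∀ z ∈ frontier Ω, v z ≤ (φ z : EReal)) ∧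
        ∀ j, ∃ C : ℝ, ∀ᶠ z in 𝓝[≠] (x j), v z ≤ h j z + (C : EReal) :=
  ⟨fun hv => ⟨hv.subOn.usc, hv.subOn.ne_top,
    hv.subOn.jet.fSubharmonicOn F.isClosed' hΩ (hv.subOn.usc.mono subset_closure)
      (fun y hy => hv.subOn.ne_top y (subset_closure hy)), hv.le_boundary, hv.le_pole⟩,
    fun hv => ⟨⟨hv.1, hv.2.1, hv.2.2.1.jetSub⟩, hv.2.2.2.1, hv.2.2.2.2⟩⟩

lemma continuousOn_of_semicontinuousOn {Y : Set (EucSp n)} {f : EucSp n → ℝ}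
    (h1 : UpperSemicontinuousOn f Y) (h2 : LowerSemicontinuousOn f Y) : ContinuousOn f Y :=
  fun y hy => tendsto_order.2 ⟨fun a ha => h2 y hy a ha, fun a ha => h1 y hy a ha⟩

/-- A function lying between its semicontinuous envelopes is continuous where these agree. -/
lemma continuousOn_toReal_of_uscEnv {K Y : Set (EucSp n)} (hYK : Y ⊆ K) {f : EucSp n → EReal}
    (hf : ∀ y ∈ Y, ((f y).toReal : EReal) = f y)
    (h1 : ∀ y ∈ Y, uscEnv K f y = f y) (h2 : ∀ y ∈ Y, uscEnv K (fun z => -f z) y = -f y) :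
    ContinuousOn (fun y => (f y).toReal) Y := by
  refine continuousOn_of_semicontinuousOn (fun y hy t ht => ?_) (fun y hy t ht => ?_)
  · have h3 : uscEnv K f y < (t : EReal) := by
      rw [h1 y hy, ← hf y hy]; exact EReal.coe_lt_coe_iff.2 ht
    filter_upwards [(upperSemicontinuousOn_uscEnv K f).mono hYK y hy _ h3,
      self_mem_nhdsWithin] with z hz hzY
    rw [h1 z hzY, ← hf z hzY] at hz
    exact EReal.coe_lt_coe_iff.1 hz
  · have h3 : uscEnv K (fun z => -f z) y < ((-t : ℝ) : EReal) := by
      rw [h2 y hy, ← hf y hy, ← EReal.coe_neg]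
      exact EReal.coe_lt_coe_iff.2 (neg_lt_neg ht)
    filter_upwards [(upperSemicontinuousOn_uscEnv K _).mono hYK y hy _ h3,
      self_mem_nhdsWithin] with z hz hzY
    rw [h2 z hzY, ← hf z hzY, ← EReal.coe_neg] at hz
    exact neg_lt_neg_iff.1 (EReal.coe_lt_coe_iff.1 hz)

/-- Shifting the function of Hypothesis (H) down gives a member of the Perron family. -/
lemma exists_memPerron_add_coe {F : ConeSubequation n} {Ω : Set (EucSp n)}
    (hb : Bornology.IsBounded Ω) {φ : EucSp n → ℝ} {M₀ : ℝ}
    (hM₀ : ∀ y ∈ frontier Ω, |φ y| ≤ M₀) {k : ℕ} {x : Fin k → EucSp n}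
    {h : Fin k → EucSp n → EReal} {ψ : EucSp n → EReal} (hψ : SubOn F Ω ψ)
    (hψh : ∀ j, ∃ C : ℝ, ∀ᶠ y in 𝓝[≠] (x j), ψ y ≤ h j y + (C : EReal)) :
    ∃ C : ℝ, MemPerron F Ω φ x h (fun y => ψ y + (C : EReal)) := by
  obtain ⟨B, hB⟩ : ∃ B : ℝ, ∀ y ∈ closure Ω, ψ y ≤ (B : EReal) := by
    rcases (closure Ω).eq_empty_or_nonempty with h0 | h0
    · exact ⟨0, fun y hy => by simp [h0] at hy⟩
    · obtain ⟨y₀, hy₀, hmax⟩ := hψ.usc.exists_isMaxOn h0 hb.isCompact_closure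
      refine ⟨(ψ y₀).toReal, fun y hy => (hmax hy).trans ?_⟩
      exact EReal.le_coe_toReal (hψ.ne_top y₀ hy₀)
  refine ⟨-M₀ - B, hψ.add_coe _, fun z hz => ?_, fun j => ?_⟩
  · rw [EReal.add_coe_le_coe_iff]
    refine (hB z (frontier_subset_closure hz)).trans (EReal.coe_le_coe_iff.2 ?_)
    linarith [(abs_le.1 (hM₀ z hz)).1]
  · obtain ⟨C, hC⟩ := hψh j
    refine ⟨C + (-M₀ - B), ?_⟩
    filter_upwards [hC] with y hy
    rw [EReal.coe_add, ← add_assoc]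
    gcongr

end

/-- Theorem 1.4, existence in the polar case: under (F3), strict F-convexity
of ∂Ω and Hypothesis (H), the Dirichlet problem with prescribed polar singularities h_j has
a solution H, uniquely determined as the Perron function of the family of F-subharmonic
functions v with v ≤ φ on ∂Ω and v − h_j bounded above near each x_j. -/
theorem dirichlet_singularities_stmt10 {n k : ℕ} (F : ConeSubequation n) (hF3 : CondF3 F)
    (Ω : Set (EucSp n)) (hΩ : IsBoundedDomain Ω) (hbdry : StrictlyConvexBoundary F Ω)
    (φ : EucSp n → ℝ) (hφ : ContinuousOn φ (frontier Ω))
    (x : Fin k → EucSp n) (hx : ∀ j, x j ∈ Ω)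
    (U : Fin k → Set (EucSp n)) (h : Fin k → EucSp n → EReal)
    (hh : ∀ j, DPSingular F (U j) (x j) (h j)) (hpolar : ∀ j, h j (x j) = ⊥)
    -- Hypothesis (H):
    (ψ : EucSp n → EReal) (hψc : ContinuousOn ψ (closure Ω))
    (hψval : ∀ y ∈ closure Ω, (ψ y = ⊥ ↔ ∃ j, y = x j) ∧ ψ y ≠ ⊤)
    (hψsub : FSubharmonicOn F.carrier Ω ψ)
    (hψasymp : ∀ j, ∃ C : ℝ, ∀ᶠ y in 𝓝[≠] (x j),
      h j y - (C : EReal) ≤ ψ y ∧ ψ y ≤ h j y + (C : EReal)) :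
    ∃ H : EucSp n → ℝ,
      (ContinuousOn H (closure Ω \ Set.range x) ∧
       FHarmonicOn F (Ω \ Set.range x) (fun y => (H y : EReal)) ∧
       (∀ y ∈ frontier Ω, H y = φ y) ∧
       (∀ j, PolarAsymp H (h j) (x j))) ∧
      ∀ y ∈ closure Ω \ Set.range x,
        (H y : EReal) = ⨆ v ∈ {v : EucSp n → EReal |
            UpperSemicontinuousOn v (closure Ω) ∧ (∀ z ∈ closure Ω, v z ≠ ⊤) ∧
            FSubharmonicOn F.carrier Ω v ∧
            (∀ z ∈ frontier Ω, v z ≤ (φ z : EReal)) ∧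
            ∀ j, ∃ C : ℝ, ∀ᶠ z in 𝓝[≠] (x j), v z ≤ h j z + (C : EReal)}, v y := by
  obtain ⟨hΩo, -, hΩb⟩ := hΩ
  have hfr : ∀ y ∈ frontier Ω, y ∉ Set.range x := by
    rintro y hy ⟨j, rfl⟩
    rw [hΩo.frontier_eq] at hy
    exact hy.2 (hx j)
  have hopen : IsOpen (Ω \ Set.range x) := hΩo.sdiff (Set.finite_range x).isClosed
  obtain ⟨M₀, hM₀⟩ := (hΩb.isCompact_closure.of_isClosed_subset isClosed_frontier
    frontier_subset_closure).exists_bound_of_continuousOn hφ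
  obtain ⟨M, hM⟩ := exists_bound_of_le_frontier F hΩo hΩb M₀
  have hbound : ∀ v, MemPerron F Ω φ x h v → ∀ y ∈ closure Ω, v y ≤ (M : EReal) := fun v hv =>
    hM v hv.subOn fun y hy => (hv.le_boundary y hy).trans
      (EReal.coe_le_coe_iff.2 ((le_abs_self _).trans (hM₀ y hy)))
  -- the shifted subsolution of Hypothesis (H)
  have hψS : SubOn F Ω ψ :=
    ⟨fun y hy t ht => (hψc y hy).eventually (gt_mem_nhds ht), fun y hy => (hψval y hy).2,
      hψsub.jetSub⟩
  obtain ⟨C₁, hψ₁⟩ := exists_memPerron_add_coe (φ := φ) hΩb hM₀ (h := h) hψS fun j =>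
    (hψasymp j).imp fun C hC => hC.mono fun y hy => hy.2
  set ψ₁ : EucSp n → EReal := fun y => ψ y + (C₁ : EReal) with hψ₁def
  have hψ₁c : ContinuousOn ψ₁ (closure Ω) := fun y hy =>
    Tendsto.comp (EReal.continuousAt_add (p := (ψ y, (C₁ : EReal))) (by simp) (by simp))
      ((hψc y hy).prodMk_nhds tendsto_const_nhds)
  have hψ₁bot : ∀ y ∈ closure Ω \ Set.range x, ψ₁ y ≠ ⊥ := by
    intro y hy h0
    rcases EReal.add_eq_bot_iff.1 h0 with h1 | h1
    · obtain ⟨j, hj⟩ := ((hψval y hy.1).1.1 h1)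
      exact hy.2 ⟨j, hj.symm⟩
    · exact EReal.coe_ne_bot _ h1
  set P := perron F Ω φ x h with hP
  set S := uscEnv (closure Ω) P with hSdef
  set J := uscEnv (closure Ω) (fun y => -P y) with hJdef
  have hPM : ∀ y ∈ closure Ω, P y ≤ (M : EReal) := fun y hy =>
    perron_le fun v hv => hbound v hv y hy
  have hSM : ∀ y ∈ closure Ω, S y ≤ (M : EReal) := fun y hy =>
    uscEnv_le (g := fun _ => (M : EReal)) hy continuousWithinAt_const
      (eventually_mem_nhdsWithin.mono hPM)
  -- upper bound at the poles
  have hpole : ∀ j, ∃ C : ℝ, ∀ᶠ y in 𝓝[≠] (x j), S y ≤ h j y + (C : EReal) := by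
    intro j
    obtain ⟨C, r, hr, hball, hv⟩ := (hh j).exists_uniform_bound (hpolar j) hΩo (hx j) M
    have hPC : ∀ y ∈ Metric.ball (x j) r \ {x j}, P y ≤ h j y + (C : EReal) := fun y hy =>
      perron_le fun v hv' => hv v hv'.subOn (hbound v hv') (hv'.le_pole j) y hy.1 hy.2
    refine ⟨C, ?_⟩
    filter_upwards [mem_nhdsWithin_of_mem_nhds (Metric.ball_mem_nhds (x j) hr),
      self_mem_nhdsWithin] with y hy hyne
    have hyU := hball (Metric.ball_subset_closedBall hy)
    refine uscEnv_le (g := fun y => h j y + (C : EReal)) (subset_closure hyU.1) ?_ ?_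
    · have hc : ContinuousAt (h j) y :=
        ((hh j).cont y hyU.2).continuousAt ((hh j).isOpen'.mem_nhds hyU.2)
      exact ContinuousAt.continuousWithinAt (Tendsto.comp
        (EReal.continuousAt_add (p := (h j y, (C : EReal))) (by simp) (by simp))
        (hc.prodMk_nhds tendsto_const_nhds))
    · exact nhdsWithin_le_nhds (Filter.mem_of_superset
        ((Metric.isOpen_ball.sdiff isClosed_singleton).mem_nhds ⟨hy, hyne⟩) hPC)
  -- the Perron function is its own upper envelope
  have hSmem : MemPerron F Ω φ x h S :=
    ⟨⟨upperSemicontinuousOn_uscEnv _ _,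
      fun y hy => ((hSM y hy).trans_lt (EReal.coe_lt_top M)).ne,
      jetSub_uscEnv_iSup hΩo fun v hv => hv.subOn⟩,
      fun y hy => uscEnv_perron_le hΩo hΩb hbound hφ hy (hbdry.exists_barrier hF3 hy), hpole⟩
  have hSP : ∀ y ∈ closure Ω, S y = P y := fun y hy =>
    (hSmem.le_perron y).antisymm (le_uscEnv P hy)
  -- the lower envelope
  have hJψ : ∀ y ∈ closure Ω, J y ≤ -ψ₁ y := fun y hy =>
    uscEnv_le (g := fun y => -ψ₁ y) hy ((continuous_neg.tendsto _).comp (hψ₁c y hy))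
      (Eventually.of_forall fun z => EReal.neg_le_neg_iff.2 (hψ₁.le_perron z))
  have hPJ : ∀ y ∈ closure Ω, -P y ≤ J y := fun y hy => le_uscEnv (fun y => -P y) hy
  have hPbot : ∀ y ∈ closure Ω \ Set.range x, P y ≠ ⊥ := fun y hy h0 =>
    hψ₁bot y hy (le_bot_iff.1 (h0 ▸ hψ₁.le_perron y))
  have hPtop : ∀ y ∈ closure Ω, P y ≠ ⊤ := fun y hy =>
    ((hPM y hy).trans_lt (EReal.coe_lt_top M)).ne
  have hJreal : ∀ y ∈ closure Ω \ Set.range x, ((J y).toReal : EReal) = J y := fun y hy =>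
    EReal.coe_toReal (fun h0 => hψ₁bot y hy (EReal.neg_eq_top_iff.1 (top_le_iff.1 (h0 ▸ hJψ y hy.1))))
      (fun h0 => hPtop y hy.1 (EReal.neg_eq_bot_iff.1 (le_bot_iff.1 (h0 ▸ hPJ y hy.1))))
  have hJjet : JetSub (dualSet F.carrier) (Ω \ Set.range x) J :=
    jetSub_uscEnv_neg_perron hΩo hSmem
  have hJfr : ∀ y ∈ frontier Ω, J y ≤ -(φ y : EReal) := fun y hy =>
    uscEnv_neg_perron_le hψ₁ hψ₁c hφ hy (hψ₁bot y ⟨frontier_subset_closure hy, hfr y hy⟩)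
      (fun j hj => hfr y hy ⟨j, hj⟩) (hbdry.exists_barrier hF3 hy)
  have hψ₁pole : ∀ j, ∃ C : ℝ, ∀ᶠ y in 𝓝[≠] (x j), h j y ≤ ψ₁ y + (C : EReal) := by
    intro j
    obtain ⟨C, hC⟩ := hψasymp j
    refine ⟨C - C₁, ?_⟩
    filter_upwards [hC] with y hy
    have h1 := hy.1
    rw [hψ₁def]
    dsimp only
    rw [EReal.sub_le_iff_le_add (by simp) (by simp)] at h1
    rw [add_assoc, ← EReal.coe_add]
    simpa using h1
  have hnear : ∀ j, ∀ᶠ y in 𝓝[≠] (x j), y ∈ (Ω \ Set.range x) ∩ U j := by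
    intro j
    have h1 : ∀ᶠ y in 𝓝[≠] (x j), y ∉ Set.range x := by
      have h2 : (Set.range x \ {x j})ᶜ ∈ 𝓝 (x j) :=
        ((Set.finite_range x).sdiff.isClosed.isOpen_compl).mem_nhds (by simp)
      filter_upwards [mem_nhdsWithin_of_mem_nhds h2, self_mem_nhdsWithin] with y h3 h4 h5
      exact h3 ⟨h5, h4⟩
    filter_upwards [h1, mem_nhdsWithin_of_mem_nhds (hΩo.mem_nhds (hx j)),
      mem_nhdsWithin_of_mem_nhds ((hh j).isOpen'.mem_nhds (hh j).mem)] with y h2 h3 h4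
    exact ⟨⟨h3, h2⟩, h4⟩
  -- comparison of the two envelopes
  have hSJ : ∀ y ∈ closure Ω \ Set.range x, S y ≤ ((-(J y).toReal : ℝ) : EReal) := by
    refine F.comparison_of_poles (g := fun y => -(J y).toReal) hΩo hΩb (Set.finite_range x)
      (by rintro _ ⟨j, rfl⟩; exact hx j) hSmem.subOn ?_ ?_ hSM ?_ ?_
    · intro y hy t ht
      have h1 : J y < ((-t : ℝ) : EReal) := by
        rw [← hJreal y hy, EReal.coe_lt_coe_iff]
        exact lt_neg_of_lt_neg ht
      filter_upwards [(upperSemicontinuousOn_uscEnv (closure Ω) (fun y => -P y)).mono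
        Set.sdiff_subset y hy _ h1, self_mem_nhdsWithin] with z hz hzY
      change J z < _ at hz
      rw [← hJreal z hzY, EReal.coe_lt_coe_iff] at hz
      exact lt_neg_of_lt_neg hz
    · refine hJjet.congr hopen fun y hy => ?_
      rw [neg_neg, hJreal y ⟨subset_closure hy.1, hy.2⟩]
    · intro y hy
      have hyc : y ∈ closure Ω \ Set.range x := ⟨frontier_subset_closure hy, hfr y hy⟩
      refine (hSmem.le_boundary y hy).trans (EReal.coe_le_coe_iff.2 ?_)
      have h1 := hJfr y hy
      rw [← hJreal y hyc, ← EReal.coe_neg, EReal.coe_le_coe_iff] at h1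
      linarith
    · rintro _ ⟨j, rfl⟩
      obtain ⟨C, hC⟩ := hpole j
      obtain ⟨C', hC'⟩ := hψ₁pole j
      obtain ⟨h1, -, -, h4⟩ := (hh j).toReal_spec (hpolar j)
      refine ⟨⟨C' + C, ?_⟩, ?_⟩
      · filter_upwards [hC, hC', hnear j] with y hy1 hy2 hy3
        have hyc : y ∈ closure Ω \ Set.range x := ⟨subset_closure hy3.1.1, hy3.1.2⟩
        have h5 : ψ₁ y ≤ ((-(J y).toReal : ℝ) : EReal) := by
          rw [EReal.coe_neg, hJreal y hyc, EReal.le_neg]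
          exact hJψ y hyc.1
        calc S y ≤ h j y + (C : EReal) := hy1
          _ ≤ ψ₁ y + (C' : EReal) + (C : EReal) := by gcongr
          _ ≤ ((-(J y).toReal : ℝ) : EReal) + (C' : EReal) + (C : EReal) := by gcongr
          _ = ((-(J y).toReal + (C' + C) : ℝ) : EReal) := by push_cast; rw [add_assoc]
      · refine tendsto_atBot_mono' _ ?_ (tendsto_atBot_add_const_right _ C h4)
        filter_upwards [hC, hnear j, self_mem_nhdsWithin] with y hy1 hy3 hy4
        have hyc : y ∈ closure Ω \ Set.range x := ⟨subset_closure hy3.1.1, hy3.1.2⟩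
        have h5 : ((-(J y).toReal : ℝ) : EReal) ≤ S y := by
          rw [hSP y hyc.1, EReal.coe_neg, hJreal y hyc, EReal.neg_le]
          exact hPJ y hyc.1
        have h6 := h5.trans hy1
        rw [← h1 y ⟨hy3.2, hy4⟩, ← EReal.coe_add, EReal.coe_le_coe_iff] at h6
        exact h6
  have hPreal : ∀ y ∈ closure Ω \ Set.range x, ((P y).toReal : EReal) = P y := fun y hy =>
    EReal.coe_toReal (hPtop y hy.1) (hPbot y hy)
  have hJP : ∀ y ∈ closure Ω \ Set.range x, J y = -P y := by
    intro y hy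
    refine le_antisymm ?_ (hPJ y hy.1)
    have h1 := hSJ y hy
    rwa [hSP y hy.1, EReal.coe_neg, hJreal y hy, EReal.le_neg] at h1
  have hcont : ContinuousOn (fun y => (P y).toReal) (closure Ω \ Set.range x) :=
    continuousOn_toReal_of_uscEnv Set.sdiff_subset hPreal (fun y hy => hSP y hy.1) hJP
  have hsub : Ω \ Set.range x ⊆ closure Ω \ Set.range x := Set.sdiff_subset_sdiff_left subset_closure
  have hcontE : ContinuousOn (fun y => (((P y).toReal : ℝ) : EReal)) (Ω \ Set.range x) :=
    continuous_coe_real_ereal.comp_continuousOn (hcont.mono hsub)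
  refine ⟨fun y => (P y).toReal, ⟨hcont, ⟨?_, ?_⟩, ?_, ?_⟩, ?_⟩
  · refine JetSub.fSubharmonicOn F.isClosed' hopen ?_ hcontE.upperSemicontinuousOn (by simp)
    refine (hSmem.subOn.jet.mono Set.sdiff_subset).congr hopen fun y hy => ?_
    rw [hPreal y (hsub hy), hSP y (hsub hy).1]
  · refine JetSub.fSubharmonicOn (isClosed_dualSet _) hopen ?_
      (continuous_neg.comp_continuousOn hcontE).upperSemicontinuousOn
      (fun y _ => by rw [← EReal.coe_neg]; exact EReal.coe_ne_top _)
    refine hJjet.congr hopen fun y hy => ?_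
    change J y = -(((P y).toReal : ℝ) : EReal)
    rw [hPreal y (hsub hy), hJP y (hsub hy)]
  · intro y hy
    have hyc : y ∈ closure Ω \ Set.range x := ⟨frontier_subset_closure hy, hfr y hy⟩
    have h1 := hSmem.le_boundary y hy
    rw [hSP y hyc.1, ← hPreal y hyc, EReal.coe_le_coe_iff] at h1
    have h2 := hJfr y hy
    rw [hJP y hyc, EReal.neg_le_neg_iff, ← hPreal y hyc, EReal.coe_le_coe_iff] at h2
    exact le_antisymm h1 h2
  · intro j
    obtain ⟨C, hC⟩ := hpole j
    obtain ⟨C', hC'⟩ := hψ₁pole j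
    refine ⟨max C C', ?_⟩
    filter_upwards [hC, hC', hnear j] with y hy1 hy2 hy3
    have hyc : y ∈ closure Ω \ Set.range x := ⟨subset_closure hy3.1.1, hy3.1.2⟩
    rw [hPreal y hyc]
    constructor
    · rw [EReal.sub_le_iff_le_add (by simp) (by simp)]
      refine hy2.trans (add_le_add (hψ₁.le_perron y) (EReal.coe_le_coe_iff.2 (le_max_right _ _)))
    · rw [← hSP y hyc.1]
      exact hy1.trans (by gcongr; exact le_max_left _ _)
  · intro y hy
    have hset : {v : EucSp n → EReal |
            UpperSemicontinuousOn v (closure Ω) ∧ (∀ z ∈ closure Ω, v z ≠ ⊤) ∧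
            FSubharmonicOn F.carrier Ω v ∧
            (∀ z ∈ frontier Ω, v z ≤ (φ z : EReal)) ∧
            ∀ j, ∃ C : ℝ, ∀ᶠ z in 𝓝[≠] (x j), v z ≤ h j z + (C : EReal)}
        = {v | MemPerron F Ω φ x h v} := Set.ext fun v => (memPerron_iff hΩo).symm
    rw [hset]
    exact hPreal y hy
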